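/- arXiv:2007.08936 — 3 statements merged into one kernel-verified Lean document; each statement's English description precedes it below -/
import Mathlib

section
/- Let β ∈ (0, 1]. Let X and Y be random variables with values in separable metric spaces (𝒳, d) and (𝒴, d), Z := (X, Y), θ := L(Z), and θₙ the empirical measure of Z₁, ..., Zₙ, where (Z_k)_{k∈ℕ} is a strictly stationary and ergodic sequence with L(Z₁) = θ. If X and Y have finite β-moments, i.e. E d(X, x₀)^β < ∞ and E d(Y, y₀)^β < ∞, then dcov_β(θₙ) → dcov_β(θ) almost surely as n → ∞. -/
open MeasureTheory Filter Topology
open scoped ENNReal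

noncomputable section

/-- The shift map on path space. -/
def shift {𝒵 : Type*} (x : ℕ → 𝒵) : ℕ → 𝒵 := fun i => x (i + 1)

/-- Empirical measure of `Z₁, …, Zₙ` (indexed here as `Z 0, …, Z (n-1)`). -/
def emp {Ω 𝒵 : Type*} [MeasurableSpace 𝒵] (Z : ℕ → Ω → 𝒵) (n : ℕ) (ω : Ω) : Measure 𝒵 :=
  (n : ℝ≥0∞)⁻¹ • ∑ k ∈ Finset.range n, Measure.dirac (Z k ω)

/-- `a_μ(x) = ∫ ρ(x,x') dμ(x')`. -/
def aM {X : Type*} [MeasurableSpace X] (ρ : X → X → ℝ) (μ : Measure X) (x : X) : ℝ :=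
  ∫ x', ρ x x' ∂μ

/-- `D(μ) = ∫ ρ(x,x') dμ²(x,x')`. -/
def DM {X : Type*} [MeasurableSpace X] (ρ : X → X → ℝ) (μ : Measure X) : ℝ :=
  ∫ p : X × X, ρ p.1 p.2 ∂(μ.prod μ)

/-- `d_μ(x,x') = ρ(x,x') - a_μ(x) - a_μ(x') + D(μ)`. -/
def dM {X : Type*} [MeasurableSpace X] (ρ : X → X → ℝ) (μ : Measure X) (x x' : X) : ℝ :=
  ρ x x' - aM ρ μ x - aM ρ μ x' + DM ρ μ

/-- `δ_θ(z,z') = d_μ(x,x') d_ν(y,y')` where `μ, ν` are the marginals of `θ`. -/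
def deltaTheta {X Y : Type*} [MeasurableSpace X] [MeasurableSpace Y]
    (ρX : X → X → ℝ) (ρY : Y → Y → ℝ) (θ : Measure (X × Y)) (z z' : X × Y) : ℝ :=
  dM ρX (θ.map Prod.fst) z.1 z'.1 * dM ρY (θ.map Prod.snd) z.2 z'.2

/-- The distance covariance `dcov(θ) = ∫ δ_θ dθ²` w.r.t. the (pseudo)metrics `ρX, ρY`;
for `ρX = dX^β`, `ρY = dY^β` this is `dcov_β(θ)`. -/
def dcov {X Y : Type*} [MeasurableSpace X] [MeasurableSpace Y]
    (ρX : X → X → ℝ) (ρY : Y → Y → ℝ) (θ : Measure (X × Y)) : ℝ :=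
  ∫ p : (X × Y) × (X × Y), deltaTheta ρX ρY θ p.1 p.2 ∂(θ.prod θ)


/-! ### Pointwise ergodic theorem -/

/-- Running maxima of Birkhoff sums. -/
def maxSum {α : Type*} (T : α → α) (f : α → ℝ) : ℕ → α → ℝ
  | 0 => fun _ => 0
  | n + 1 => fun x => max 0 (f x + maxSum T f n (T x))

lemma maxSum_nonneg {α : Type*} (T : α → α) (f : α → ℝ) (n : ℕ) (x : α) :
    0 ≤ maxSum T f n x := by
  cases n with
  | zero => exact le_rfl
  | succ n => exact le_max_left _ _

lemma maxSum_succ_le {α : Type*} (T : α → α) (f : α → ℝ) (n : ℕ) :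
    ∀ x, maxSum T f n x ≤ maxSum T f (n + 1) x := by
  induction n with
  | zero => intro x; exact le_max_left _ _
  | succ n ih =>
    intro x
    have := ih (T x)
    simp only [maxSum] at this ⊢
    exact max_le_max le_rfl (by linarith)

lemma maxSum_mono {α : Type*} (T : α → α) (f : α → ℝ) (x : α) :
    Monotone (fun n => maxSum T f n x) :=
  monotone_nat_of_le_succ fun n => maxSum_succ_le T f n x

lemma sum_le_maxSum {α : Type*} (T : α → α) (f : α → ℝ) (n : ℕ) :
    ∀ x, ∑ k ∈ Finset.range n, f (T^[k] x) ≤ maxSum T f n x := by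
  induction n with
  | zero => intro x; simp [maxSum]
  | succ n ih =>
    intro x
    rw [Finset.sum_range_succ']
    have := ih (T x)
    simp only [maxSum, Function.iterate_succ, Function.comp, Function.iterate_zero, id]
    exact le_max_of_le_right (by linarith)

lemma measurable_maxSum {α : Type*} [MeasurableSpace α] {T : α → α} {f : α → ℝ}
    (hT : Measurable T) (hf : Measurable f) (n : ℕ) : Measurable (maxSum T f n) := by
  induction n with
  | zero => exact measurable_const
  | succ n ih => exact measurable_const.max (hf.add (ih.comp hT))

lemma integrable_maxSum {α : Type*} [MeasurableSpace α] {μ : Measure α} [IsProbabilityMeasure μ]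
    {T : α → α} {f : α → ℝ}
    (hT : MeasurePreserving T μ μ) (hi : Integrable f μ) (n : ℕ) :
    Integrable (maxSum T f n) μ := by
  induction n with
  | zero => exact integrable_const 0
  | succ n ih =>
    exact (integrable_const (0 : ℝ)).sup (hi.add (hT.integrable_comp_of_integrable ih))

lemma ae_bdd_maxSum {α : Type*} [MeasurableSpace α] {μ : Measure α} [IsProbabilityMeasure μ]
    {T : α → α} {f : α → ℝ} (hT : Ergodic T μ) (hf : Measurable f) (hi : Integrable f μ)
    (hneg : ∫ x, f x ∂μ < 0) : ∀ᵐ x ∂μ, ∃ C : ℕ, ∀ n, maxSum T f n x ≤ C := by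
  set B : Set α := {x | ∃ C : ℕ, ∀ n, maxSum T f n x ≤ C} with hB
  have hBm : MeasurableSet B := by
    have : B = ⋃ C : ℕ, ⋂ n, {x | maxSum T f n x ≤ C} := by ext; simp [hB]
    rw [this]
    exact MeasurableSet.iUnion fun C => MeasurableSet.iInter fun n =>
      measurableSet_le (measurable_maxSum hT.measurable hf n) measurable_const
  have hinv : T ⁻¹' B = B := by
    ext x
    simp only [hB, Set.mem_preimage, Set.mem_setOf_eq]
    constructor
    · rintro ⟨C, hC⟩
      obtain ⟨D, hD⟩ := exists_nat_ge (max 0 (f x + C))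
      refine ⟨D, fun n => ?_⟩
      refine (maxSum_succ_le T f n x).trans (le_trans ?_ hD)
      simp only [maxSum]
      exact max_le_max le_rfl (by linarith [hC n])
    · rintro ⟨C, hC⟩
      obtain ⟨D, hD⟩ := exists_nat_ge (C - f x)
      refine ⟨D, fun n => ?_⟩
      have h1 := hC (n + 1)
      have h2 : f x + maxSum T f n (T x) ≤ maxSum T f (n + 1) x := le_max_right _ _
      linarith
  rcases hT.toPreErgodic.ae_mem_or_ae_notMem hBm hinv with h | h
  · exact h
  exfalso
  have hlim : Tendsto (fun n => ∫ x, (maxSum T f (n + 1) x - maxSum T f n (T x)) ∂μ) atTop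
      (𝓝 (∫ x, f x ∂μ)) := by
    refine tendsto_integral_of_dominated_convergence (fun x => |f x|) ?_ hi.abs ?_ ?_
    · intro n
      exact ((measurable_maxSum hT.measurable hf (n + 1)).sub
        ((measurable_maxSum hT.measurable hf n).comp hT.measurable)).aestronglyMeasurable
    · intro n
      refine Eventually.of_forall fun x => ?_
      have h0 := maxSum_nonneg T f n (T x)
      simp only [maxSum, Real.norm_eq_abs]
      rcases max_cases 0 (f x + maxSum T f n (T x)) with ⟨h1, h2⟩ | ⟨h1, h2⟩
      · rw [h1, zero_sub, abs_neg, abs_of_nonneg h0]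
        linarith [neg_le_abs (f x)]
      · rw [h1, add_sub_cancel_right]
    · filter_upwards [h] with x hx
      have hx' : T x ∉ B := by
        intro hh
        exact hx (by rw [← hinv]; exact hh)
      simp only [hB, Set.mem_setOf_eq, not_exists, not_forall, not_le] at hx'
      obtain ⟨D, hD⟩ := exists_nat_ge (-f x)
      obtain ⟨N, hN⟩ := hx' D
      refine tendsto_const_nhds.congr' ?_
      filter_upwards [eventually_ge_atTop N] with n hn
      have := maxSum_mono T f (T x) hn
      simp only [maxSum]
      simp only at this
      rw [max_eq_right (by linarith)]
      ring
  have hnn : 0 ≤ ∫ x, f x ∂μ := by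
    refine ge_of_tendsto' hlim fun n => ?_
    have hi1 := integrable_maxSum hT.toMeasurePreserving hi (n + 1)
    have hi0 := integrable_maxSum hT.toMeasurePreserving hi n
    have hic : Integrable (fun x => maxSum T f n (T x)) μ :=
      hT.toMeasurePreserving.integrable_comp_of_integrable hi0
    rw [integral_sub hi1 hic]
    have e : ∫ x, maxSum T f n (T x) ∂μ = ∫ x, maxSum T f n x ∂μ := by
      conv_rhs => rw [← hT.toMeasurePreserving.map_eq]
      rw [integral_map hT.measurable.aemeasurable]
      exact (measurable_maxSum hT.measurable hf n).aestronglyMeasurable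
    rw [e, sub_nonneg]
    exact integral_mono hi0 hi1 (maxSum_succ_le T f n)
  linarith

lemma birkhoff_upper {α : Type*} [MeasurableSpace α] {μ : Measure α} [IsProbabilityMeasure μ]
    {T : α → α} {f : α → ℝ} (hT : Ergodic T μ) (hf : Measurable f) (hi : Integrable f μ)
    {ε : ℝ} (hε : 0 < ε) :
    ∀ᵐ x ∂μ, ∀ᶠ n : ℕ in atTop,
      (n : ℝ)⁻¹ * ∑ k ∈ Finset.range n, f (T^[k] x) ≤ ∫ x, f x ∂μ + ε := by
  set I := ∫ x, f x ∂μ with hI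
  have h := ae_bdd_maxSum (f := fun x => f x - (I + ε / 2)) hT (hf.sub_const _)
    (hi.sub (integrable_const _)) (by
      rw [integral_sub hi (integrable_const _)]; simp [← hI]; linarith)
  filter_upwards [h] with x hx
  obtain ⟨C, hC⟩ := hx
  obtain ⟨N, hN⟩ := exists_nat_ge (C / (ε / 2))
  filter_upwards [eventually_ge_atTop (N + 1)] with n hn
  have h1 := (sum_le_maxSum T (fun x => f x - (I + ε / 2)) n x).trans (hC n)
  rw [Finset.sum_sub_distrib] at h1
  simp only [Finset.sum_const, Finset.card_range, nsmul_eq_mul] at h1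
  have hn' : (N : ℝ) + 1 ≤ n := by exact_mod_cast hn
  have hN0 : (0 : ℝ) ≤ N := Nat.cast_nonneg N
  have hpos : (0 : ℝ) < n := by linarith
  rw [div_le_iff₀ (by positivity)] at hN
  rw [inv_mul_le_iff₀ hpos]
  nlinarith

theorem birkhoff_ergodic {α : Type*} [MeasurableSpace α] {μ : Measure α} [IsProbabilityMeasure μ]
    {T : α → α} {f : α → ℝ} (hT : Ergodic T μ) (hf : Measurable f) (hi : Integrable f μ) :
    ∀ᵐ x ∂μ, Tendsto (fun n : ℕ => (n : ℝ)⁻¹ * ∑ k ∈ Finset.range n, f (T^[k] x)) atTop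
      (𝓝 (∫ x, f x ∂μ)) := by
  have h1 : ∀ᵐ x ∂μ, ∀ m : ℕ, ∀ᶠ n : ℕ in atTop,
      (n : ℝ)⁻¹ * ∑ k ∈ Finset.range n, f (T^[k] x) ≤ ∫ x, f x ∂μ + 1 / ((m : ℝ) + 1) :=
    ae_all_iff.2 fun m => birkhoff_upper hT hf hi (by positivity)
  have h2 : ∀ᵐ x ∂μ, ∀ m : ℕ, ∀ᶠ n : ℕ in atTop,
      (n : ℝ)⁻¹ * ∑ k ∈ Finset.range n, (-f (T^[k] x)) ≤
        ∫ x, -f x ∂μ + 1 / ((m : ℝ) + 1) :=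
    ae_all_iff.2 fun m => birkhoff_upper (f := fun x => -f x) hT hf.neg hi.neg (by positivity)
  filter_upwards [h1, h2] with x hx1 hx2
  rw [Metric.tendsto_nhds]
  intro ε hε
  obtain ⟨m, hm⟩ := exists_nat_one_div_lt hε
  filter_upwards [hx1 m, hx2 m] with n a b
  rw [integral_neg, Finset.sum_neg_distrib, mul_neg] at b
  rw [Real.dist_eq, abs_lt]
  constructor <;> linarith

/-! ### Empirical measures -/

lemma shift_iterate {𝒵 : Type*} (k : ℕ) : ∀ (x : ℕ → 𝒵) (i : ℕ), (shift^[k] x) i = x (i + k) := by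
  induction k with
  | zero => intro x i; rfl
  | succ k ih =>
    intro x i
    rw [Function.iterate_succ_apply, ih]
    simp only [shift]
    congr 1

instance isProb_emp {Ω 𝒵 : Type*} [MeasurableSpace 𝒵] (Z : ℕ → Ω → 𝒵) (n : ℕ) (ω : Ω) :
    IsProbabilityMeasure (emp Z (n + 1) ω) := by
  constructor
  simp only [emp, Measure.smul_apply, Measure.finsetSum_apply, measure_univ, Finset.sum_const,
    Finset.card_range, smul_eq_mul, nsmul_eq_mul, mul_one]
  exact ENNReal.inv_mul_cancel (by simp) (by simp)

/-- The empirical measure of the first `n + 1` observations as a probability measure. -/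
def empPM {Ω 𝒵 : Type*} [MeasurableSpace 𝒵] (Z : ℕ → Ω → 𝒵) (n : ℕ) (ω : Ω) :
    ProbabilityMeasure 𝒵 := ⟨emp Z (n + 1) ω, isProb_emp Z n ω⟩

lemma integrable_emp {Ω 𝒵 : Type*} [MeasurableSpace 𝒵] (Z : ℕ → Ω → 𝒵) (n : ℕ) (ω : Ω)
    {g : 𝒵 → ℝ} (hg : Measurable g) : Integrable g (emp Z (n + 1) ω) := by
  refine Integrable.smul_measure ?_ (by simp)
  exact integrable_finsetSum_measure.2 fun k _ => integrable_dirac' hg.stronglyMeasurable (by simp)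

lemma integral_emp {Ω 𝒵 : Type*} [MeasurableSpace 𝒵] (Z : ℕ → Ω → 𝒵) (n : ℕ) (ω : Ω)
    {g : 𝒵 → ℝ} (hg : Measurable g) :
    ∫ z, g z ∂(emp Z n ω) = (n : ℝ)⁻¹ * ∑ k ∈ Finset.range n, g (Z k ω) := by
  rw [emp, integral_smul_measure, integral_finsetSum_measure]
  · simp [integral_dirac' _ _ hg.stronglyMeasurable]
  · intro k _
    exact integrable_dirac' hg.stronglyMeasurable (by simp)

lemma emp_ergodic {Ω 𝒵 : Type*} [MeasurableSpace 𝒵] [MeasurableSpace Ω]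
    (P : Measure Ω) [IsProbabilityMeasure P] (Z : ℕ → Ω → 𝒵) (hZ : ∀ i, Measurable (Z i))
    (herg : Ergodic shift (P.map fun ω i => Z i ω)) {g : 𝒵 → ℝ} (hg : Measurable g)
    (hgi : Integrable g (P.map (Z 0))) :
    ∀ᵐ ω ∂P, Tendsto (fun n => ∫ z, g z ∂(emp Z n ω)) atTop (𝓝 (∫ z, g z ∂(P.map (Z 0)))) := by
  have hm : Measurable (fun ω i => Z i ω) := measurable_pi_iff.2 hZ
  haveI : IsProbabilityMeasure (P.map fun ω i => Z i ω) :=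
    Measure.isProbabilityMeasure_map hm.aemeasurable
  have hgm : Measurable (fun x : ℕ → 𝒵 => g (x 0)) := hg.comp (measurable_pi_apply 0)
  have hi : Integrable (fun x : ℕ → 𝒵 => g (x 0)) (P.map fun ω i => Z i ω) := by
    rw [integrable_map_measure hgm.aestronglyMeasurable hm.aemeasurable]
    rw [integrable_map_measure hg.aestronglyMeasurable (hZ 0).aemeasurable] at hgi
    exact hgi
  have h := ae_of_ae_map hm.aemeasurable (birkhoff_ergodic herg hgm hi)
  filter_upwards [h] with ω hω
  rw [integral_map hm.aemeasurable hgm.aestronglyMeasurable] at hω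
  rw [integral_map (hZ 0).aemeasurable hg.aestronglyMeasurable]
  simp only [shift_iterate, zero_add] at hω
  simp only [integral_emp Z _ ω hg]
  exact hω

lemma emp_weak {Ω 𝒵 : Type*} [MeasurableSpace 𝒵] [TopologicalSpace 𝒵] [SecondCountableTopology 𝒵]
    [OpensMeasurableSpace 𝒵] [MeasurableSpace Ω]
    (P : Measure Ω) [IsProbabilityMeasure P] (Z : ℕ → Ω → 𝒵) (hZ : ∀ i, Measurable (Z i))
    (herg : Ergodic shift (P.map fun ω i => Z i ω))
    (θ : ProbabilityMeasure 𝒵) (hθ : (θ : Measure 𝒵) = P.map (Z 0)) :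
    ∀ᵐ ω ∂P, Tendsto (fun n => empPM Z n ω) atTop
      (𝓝 θ) := by
  let S : Set (Set 𝒵) := (fun F => ⋂₀ F) ''
    {F : Set (Set 𝒵) | F.Finite ∧ F ⊆ TopologicalSpace.countableBasis 𝒵}
  have hSc : S.Countable :=
    (Set.countable_setOf_finite_subset (TopologicalSpace.countable_countableBasis 𝒵)).image _
  have hSo : ∀ s ∈ S, IsOpen s := by
    rintro _ ⟨F, ⟨hF, hFs⟩, rfl⟩
    exact hF.isOpen_sInter fun t ht => TopologicalSpace.isOpen_of_mem_countableBasis (hFs ht)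
  have hpi : IsPiSystem S := by
    rintro _ ⟨F, ⟨hF, hFs⟩, rfl⟩ _ ⟨G, ⟨hG, hGs⟩, rfl⟩ -
    exact ⟨F ∪ G, ⟨hF.union hG, Set.union_subset hFs hGs⟩, Set.sInter_union F G⟩
  have hall : ∀ᵐ ω ∂P, ∀ s ∈ S, Tendsto (fun n => ∫ z, s.indicator (fun _ => (1 : ℝ)) z
      ∂(emp Z n ω)) atTop (𝓝 (∫ z, s.indicator (fun _ => (1 : ℝ)) z ∂(P.map (Z 0)))) := by
    rw [ae_ball_iff hSc]
    intro s hs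
    haveI : IsProbabilityMeasure (P.map (Z 0)) :=
      Measure.isProbabilityMeasure_map (hZ 0).aemeasurable
    exact emp_ergodic P Z hZ herg (measurable_const.indicator (hSo s hs).measurableSet)
      ((integrable_const _).indicator (hSo s hs).measurableSet)
  filter_upwards [hall] with ω hω
  refine hpi.tendsto_probabilityMeasure_of_tendsto_of_mem
    (fun s hs => (hSo s hs).measurableSet) ?_ ?_
  · intro u hu x hx
    obtain ⟨s, hs, hxs, hsu⟩ :=
      (TopologicalSpace.isBasis_countableBasis 𝒵).exists_subset_of_mem_open hx hu
    refine ⟨s, ⟨{s}, ⟨Set.finite_singleton s, by simpa using hs⟩, by simp⟩, ?_, hsu⟩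
    exact (TopologicalSpace.isOpen_of_mem_countableBasis hs).mem_nhds hxs
  · intro s hs
    have h := (tendsto_add_atTop_iff_nat 1).2 (hω s hs)
    rw [← hθ] at h
    simp only [integral_indicator_const _ (hSo s hs).measurableSet, smul_eq_mul, mul_one] at h
    rw [← NNReal.tendsto_coe]
    exact h

/-! ### Weak convergence and integrals of dominated continuous functions -/

lemma eventually_ge_of_weak {W : Type*} [MeasurableSpace W] [TopologicalSpace W]
    [OpensMeasurableSpace W] [HasOuterApproxClosed W]
    {μ : ℕ → ProbabilityMeasure W} {ν : ProbabilityMeasure W} (hμ : Tendsto μ atTop (𝓝 ν))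
    {φ : W → ℝ} (hφ : Continuous φ) (h0 : 0 ≤ φ)
    (hi : ∀ n, Integrable φ (μ n : Measure W)) (hiν : Integrable φ (ν : Measure W))
    {ε : ℝ} (hε : 0 < ε) :
    ∀ᶠ n in atTop, ∫ w, φ w ∂(ν : Measure W) - ε < ∫ w, φ w ∂(μ n : Measure W) := by
  have h := lintegral_le_liminf_lintegral_of_forall_isOpen_measure_le_liminf_measure
    (μ := (ν : Measure W)) (μs := fun n => (μ n : Measure W)) hφ h0
    (fun G hG => ProbabilityMeasure.le_liminf_measure_open_of_tendsto hμ hG)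
  simp only [← ofReal_integral_eq_lintegral_ofReal hiν (Eventually.of_forall h0),
    fun n => (ofReal_integral_eq_lintegral_ofReal (hi n) (Eventually.of_forall h0)).symm] at h
  rcases le_or_gt (∫ w, φ w ∂(ν : Measure W)) 0 with hle | hlt
  · refine Eventually.of_forall fun n => ?_
    have : 0 ≤ ∫ w, φ w ∂(μ n : Measure W) := integral_nonneg h0
    linarith
  · have hlt' : ENNReal.ofReal (∫ w, φ w ∂(ν : Measure W) - ε) <
        ENNReal.ofReal (∫ w, φ w ∂(ν : Measure W)) :=
      (ENNReal.ofReal_lt_ofReal_iff hlt).2 (by linarith)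
    have := eventually_lt_of_lt_liminf (hlt'.trans_le h)
    filter_upwards [this] with n hn
    exact (ENNReal.ofReal_lt_ofReal_iff').1 hn |>.1

lemma tendsto_integral_of_weak {W : Type*} [MeasurableSpace W] [TopologicalSpace W]
    [OpensMeasurableSpace W] [HasOuterApproxClosed W]
    {μ : ℕ → ProbabilityMeasure W} {ν : ProbabilityMeasure W} (hμ : Tendsto μ atTop (𝓝 ν))
    {h g : W → ℝ} (hh : Continuous h) (hg : Continuous g) (hle : ∀ w, |h w| ≤ g w)
    (hhi : ∀ n, Integrable h (μ n : Measure W)) (hhν : Integrable h (ν : Measure W))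
    (hgi : ∀ n, Integrable g (μ n : Measure W)) (hgν : Integrable g (ν : Measure W))
    (hlim : Tendsto (fun n => ∫ w, g w ∂(μ n : Measure W)) atTop
      (𝓝 (∫ w, g w ∂(ν : Measure W)))) :
    Tendsto (fun n => ∫ w, h w ∂(μ n : Measure W)) atTop (𝓝 (∫ w, h w ∂(ν : Measure W))) := by
  rw [Metric.tendsto_nhds] at hlim ⊢
  intro ε hε
  have e1 := eventually_ge_of_weak hμ (φ := fun w => g w + h w) (hg.add hh)
    (fun w => by have := neg_abs_le (h w); have := hle w; simp only [Pi.zero_apply]; linarith)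
    (fun n => (hgi n).add (hhi n)) (hgν.add hhν) (half_pos hε)
  have e2 := eventually_ge_of_weak hμ (φ := fun w => g w - h w) (hg.sub hh)
    (fun w => by have := le_abs_self (h w); have := hle w; simp only [Pi.zero_apply]; linarith)
    (fun n => (hgi n).sub (hhi n)) (hgν.sub hhν) (half_pos hε)
  filter_upwards [e1, e2, hlim (ε / 2) (half_pos hε)] with n a b c
  rw [integral_add hgν hhν, integral_add (hgi n) (hhi n)] at a
  rw [integral_sub hgν hhν, integral_sub (hgi n) (hhi n)] at b
  rw [Real.dist_eq, abs_lt] at c ⊢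
  constructor <;> linarith

/-! ### The six-point kernel -/

/-- A continuous pseudometric given as a real function. -/
structure IsCPM {X : Type*} [TopologicalSpace X] (ρ : X → X → ℝ) : Prop where
  nonneg : ∀ a b, 0 ≤ ρ a b
  symm : ∀ a b, ρ a b = ρ b a
  tri : ∀ a b c, ρ a c ≤ ρ a b + ρ b c
  cont : Continuous (fun p : X × X => ρ p.1 p.2)

/-- The four-point kernel. -/
def ker4 {X : Type*} (ρ : X → X → ℝ) (a b c d : X) : ℝ := ρ a b - ρ a c - ρ b d + ρ c d

lemma IsCPM.ker4_le {X : Type*} [TopologicalSpace X] {ρ : X → X → ℝ} (h : IsCPM ρ) (x₀ a b c d : X) :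
    |ker4 ρ a b c d| ≤ 2 * (ρ a x₀ + ρ d x₀) := by
  have h0 : ρ a d ≤ ρ a x₀ + ρ d x₀ := by rw [h.symm d x₀]; exact h.tri a x₀ d
  have h1 := h.tri b a d
  have h2 := h.tri a d b
  have h3 := h.tri c a d
  have h4 := h.tri a d c
  rw [h.symm b a] at h1
  rw [h.symm d b] at h2
  rw [h.symm c a] at h3
  rw [h.symm d c] at h4
  unfold ker4
  rw [abs_le]; constructor <;> linarith

lemma IsCPM.ker4_le' {X : Type*} [TopologicalSpace X] {ρ : X → X → ℝ} (h : IsCPM ρ)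
    (x₀ a b c d : X) : |ker4 ρ a b c d| ≤ 2 * (ρ b x₀ + ρ c x₀) := by
  have : ker4 ρ a b c d = ker4 ρ b a d c := by
    unfold ker4; rw [h.symm b a, h.symm d c]; ring
  rw [this]
  exact h.ker4_le x₀ b a d c

section
variable {X Y : Type*}
  [MetricSpace X] [SecondCountableTopology X] [MeasurableSpace X] [BorelSpace X]
  [MetricSpace Y] [SecondCountableTopology Y] [MeasurableSpace Y] [BorelSpace Y]

/-- `dM` as an integral of the four-point kernel (along a measurable map). -/
lemma dM_eq {W : Type*} [MeasurableSpace W] {ρ : X → X → ℝ} (h : IsCPM ρ) (m : Measure W)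
    [IsProbabilityMeasure m] {π : W → X} (hπ : Measurable π) (x₀ : X)
    (hi : Integrable (fun w => ρ (π w) x₀) m) (a b : X) :
    Integrable (fun q : W × W => ker4 ρ a b (π q.1) (π q.2)) (m.prod m) ∧
    dM ρ (m.map π) a b = ∫ q : W × W, ker4 ρ a b (π q.1) (π q.2) ∂(m.prod m) := by
  have hcm : Measurable (fun p : X × X => ρ p.1 p.2) := h.cont.measurable
  have hma : ∀ a, Measurable (fun x => ρ a x) := fun a =>
    hcm.comp (measurable_const.prodMk measurable_id)
  have hia : ∀ a, Integrable (fun w => ρ a (π w)) m := by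
    intro a
    refine ((integrable_const (ρ a x₀)).add hi).mono' ((hma a).comp hπ).aestronglyMeasurable
      (Eventually.of_forall fun w => ?_)
    rw [Real.norm_of_nonneg (h.nonneg _ _), Pi.add_apply, h.symm (π w)]
    exact h.tri _ _ _
  have hm2 : Measurable (fun q : W × W => ρ (π q.1) (π q.2)) :=
    hcm.comp ((hπ.comp measurable_fst).prodMk (hπ.comp measurable_snd))
  have hi2 : Integrable (fun q : W × W => ρ (π q.1) (π q.2)) (m.prod m) := by
    refine ((hi.comp_fst m).add (hi.comp_snd m)).mono' hm2.aestronglyMeasurable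
      (Eventually.of_forall fun q => ?_)
    rw [Real.norm_of_nonneg (h.nonneg _ _)]
    simp only [Pi.add_apply]
    rw [h.symm (π q.2)]
    exact h.tri _ _ _
  have i1 : Integrable (fun q : W × W => ρ a (π q.1)) (m.prod m) := (hia a).comp_fst m
  have i2 : Integrable (fun q : W × W => ρ b (π q.2)) (m.prod m) := (hia b).comp_snd m
  have i0 : Integrable (fun _ : W × W => ρ a b) (m.prod m) := integrable_const _
  have j1 : Integrable (fun q : W × W => ρ a b - ρ a (π q.1)) (m.prod m) := i0.sub i1
  have j2 : Integrable (fun q : W × W => ρ a b - ρ a (π q.1) - ρ b (π q.2)) (m.prod m) := j1.sub i2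
  unfold ker4
  refine ⟨j2.add hi2, ?_⟩
  rw [integral_add j2 hi2, integral_sub j1 i2, integral_sub i0 i1,
    integral_fun_fst (μ := m) (ν := m) (fun w => ρ a (π w)),
    integral_fun_snd (μ := m) (ν := m) (fun w => ρ b (π w))]
  unfold dM aM DM
  rw [integral_map hπ.aemeasurable (hma a).aestronglyMeasurable,
    integral_map hπ.aemeasurable (hma b).aestronglyMeasurable,
    Measure.map_prod_map _ _ hπ hπ,
    integral_map (hπ.prodMap hπ).aemeasurable hcm.aestronglyMeasurable]
  simp

/-- The six-point kernel. -/
def ker6 (ρX : X → X → ℝ) (ρY : Y → Y → ℝ)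
    (w : ((X × Y) × (X × Y)) × (((X × Y) × (X × Y)) × ((X × Y) × (X × Y)))) : ℝ :=
  ker4 ρX w.1.1.1 w.1.2.1 w.2.1.1.1 w.2.1.2.1 * ker4 ρY w.1.1.2 w.1.2.2 w.2.2.1.2 w.2.2.2.2

/-- The dominating function. -/
def dom6 (u v : X × Y → ℝ)
    (w : ((X × Y) × (X × Y)) × (((X × Y) × (X × Y)) × ((X × Y) × (X × Y)))) : ℝ :=
  4 * (u w.1.1 * v w.1.2 + u w.1.1 * v w.2.2.1 + v w.1.2 * u w.2.1.2 + u w.2.1.2 * v w.2.2.1)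

/-- Sixth power of a measure. -/
def pow6 (m : Measure (X × Y)) : Measure
    (((X × Y) × (X × Y)) × (((X × Y) × (X × Y)) × ((X × Y) × (X × Y)))) :=
  (m.prod m).prod ((m.prod m).prod (m.prod m))

lemma abs_ker6_le {ρX : X → X → ℝ} {ρY : Y → Y → ℝ} (hX : IsCPM ρX) (hY : IsCPM ρY)
    (x₀ : X) (y₀ : Y) (w) :
    |ker6 ρX ρY w| ≤ dom6 (fun z => ρX z.1 x₀) (fun z => ρY z.2 y₀) w := by
  unfold ker6 dom6
  rw [abs_mul]
  refine (mul_le_mul (hX.ker4_le x₀ _ _ _ _) (hY.ker4_le' y₀ _ _ _ _) (abs_nonneg _) ?_).trans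
    (le_of_eq (by ring))
  have := hX.nonneg w.1.1.1 x₀
  have := hX.nonneg w.2.1.2.1 x₀
  linarith

lemma dom6_int (m : Measure (X × Y)) [IsProbabilityMeasure m] {u v : X × Y → ℝ}
    (hu : Integrable u m) (hv : Integrable v m) :
    Integrable (dom6 u v) (pow6 m) ∧
      ∫ w, dom6 u v w ∂(pow6 m) = 16 * ((∫ z, u z ∂m) * (∫ z, v z ∂m)) := by
  have u1 : Integrable (fun p : (X × Y) × (X × Y) => u p.1) (m.prod m) := hu.comp_fst m
  have v1 : Integrable (fun p : (X × Y) × (X × Y) => v p.1) (m.prod m) := hv.comp_fst m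
  have u2 : Integrable (fun p : (X × Y) × (X × Y) => u p.2) (m.prod m) := hu.comp_snd m
  have v2 : Integrable (fun p : (X × Y) × (X × Y) => v p.2) (m.prod m) := hv.comp_snd m
  have v22 := v1.comp_snd (m.prod m)
  have u21 := u2.comp_fst (m.prod m)
  have iu1 : ∫ p : (X × Y) × (X × Y), u p.1 ∂(m.prod m) = ∫ z, u z ∂m := by
    rw [integral_fun_fst (μ := m) (ν := m) u]; simp
  have iv1 : ∫ p : (X × Y) × (X × Y), v p.1 ∂(m.prod m) = ∫ z, v z ∂m := by
    rw [integral_fun_fst (μ := m) (ν := m) v]; simp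
  have iu2 : ∫ p : (X × Y) × (X × Y), u p.2 ∂(m.prod m) = ∫ z, u z ∂m := by
    rw [integral_fun_snd (μ := m) (ν := m) u]; simp
  have iv2 : ∫ p : (X × Y) × (X × Y), v p.2 ∂(m.prod m) = ∫ z, v z ∂m := by
    rw [integral_fun_snd (μ := m) (ν := m) v]; simp
  have iv22 : ∫ q : ((X × Y) × (X × Y)) × ((X × Y) × (X × Y)), v q.2.1
      ∂((m.prod m).prod (m.prod m)) = ∫ z, v z ∂m := by
    rw [integral_fun_snd (μ := m.prod m) (ν := m.prod m) (fun p => v p.1), iv1]; simp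
  have iu21 : ∫ q : ((X × Y) × (X × Y)) × ((X × Y) × (X × Y)), u q.1.2
      ∂((m.prod m).prod (m.prod m)) = ∫ z, u z ∂m := by
    rw [integral_fun_fst (μ := m.prod m) (ν := m.prod m) (fun p => u p.2), iu2]; simp
  have a1 := (hu.mul_prod hv).comp_fst ((m.prod m).prod (m.prod m))
  have a2 := u1.mul_prod v22
  have a3 := v2.mul_prod u21
  have a4 := (u2.mul_prod v1).comp_snd (m.prod m)
  have e1 : ∫ w : ((X × Y) × (X × Y)) × (((X × Y) × (X × Y)) × ((X × Y) × (X × Y))),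
      u w.1.1 * v w.1.2 ∂(m.prod m).prod ((m.prod m).prod (m.prod m)) =
      (∫ z, u z ∂m) * (∫ z, v z ∂m) := by
    rw [integral_fun_fst (μ := m.prod m) (ν := (m.prod m).prod (m.prod m))
      (fun p => u p.1 * v p.2), integral_prod_mul]
    simp
  have e2 : ∫ w : ((X × Y) × (X × Y)) × (((X × Y) × (X × Y)) × ((X × Y) × (X × Y))),
      u w.1.1 * v w.2.2.1 ∂(m.prod m).prod ((m.prod m).prod (m.prod m)) =
      (∫ z, u z ∂m) * (∫ z, v z ∂m) := by
    rw [integral_prod_mul (μ := m.prod m) (ν := (m.prod m).prod (m.prod m))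
      (fun p => u p.1) (fun q => v q.2.1), iu1, iv22]
  have e3 : ∫ w : ((X × Y) × (X × Y)) × (((X × Y) × (X × Y)) × ((X × Y) × (X × Y))),
      v w.1.2 * u w.2.1.2 ∂(m.prod m).prod ((m.prod m).prod (m.prod m)) =
      (∫ z, u z ∂m) * (∫ z, v z ∂m) := by
    rw [integral_prod_mul (μ := m.prod m) (ν := (m.prod m).prod (m.prod m))
      (fun p => v p.2) (fun q => u q.1.2), iv2, iu21, mul_comm]
  have e4 : ∫ w : ((X × Y) × (X × Y)) × (((X × Y) × (X × Y)) × ((X × Y) × (X × Y))),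
      u w.2.1.2 * v w.2.2.1 ∂(m.prod m).prod ((m.prod m).prod (m.prod m)) =
      (∫ z, u z ∂m) * (∫ z, v z ∂m) := by
    rw [integral_fun_snd (μ := m.prod m) (ν := (m.prod m).prod (m.prod m))
      (fun q => u q.1.2 * v q.2.1), integral_prod_mul (μ := m.prod m) (ν := m.prod m)
      (fun p => u p.2) (fun p => v p.1), iu2, iv1]
    simp
  unfold dom6 pow6
  have b2 : Integrable (fun w : ((X × Y) × (X × Y)) × (((X × Y) × (X × Y)) × ((X × Y) × (X × Y))) =>
      u w.1.1 * v w.1.2 + u w.1.1 * v w.2.2.1)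
      ((m.prod m).prod ((m.prod m).prod (m.prod m))) := a1.add a2
  have b3 : Integrable (fun w : ((X × Y) × (X × Y)) × (((X × Y) × (X × Y)) × ((X × Y) × (X × Y))) =>
      u w.1.1 * v w.1.2 + u w.1.1 * v w.2.2.1 + v w.1.2 * u w.2.1.2)
      ((m.prod m).prod ((m.prod m).prod (m.prod m))) := b2.add a3
  refine ⟨(b3.add a4).const_mul 4, ?_⟩
  rw [integral_const_mul, integral_add b3 a4, integral_add b2 a3,
    integral_add a1 a2]
  linear_combination 4 * (e1 + e2 + e3 + e4)

lemma continuous_ker6 {ρX : X → X → ℝ} {ρY : Y → Y → ℝ} (hX : IsCPM ρX) (hY : IsCPM ρY) :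
    Continuous (ker6 ρX ρY) := by
  have cX : ∀ {W : Type _} [TopologicalSpace W] {f g : W → X}, Continuous f → Continuous g →
      Continuous fun w => ρX (f w) (g w) := fun hf hg => hX.cont.comp (hf.prodMk hg)
  have cY : ∀ {W : Type _} [TopologicalSpace W] {f g : W → Y}, Continuous f → Continuous g →
      Continuous fun w => ρY (f w) (g w) := fun hf hg => hY.cont.comp (hf.prodMk hg)
  unfold ker6 ker4
  refine Continuous.mul ?_ ?_
  · refine (((cX ?_ ?_).sub (cX ?_ ?_)).sub (cX ?_ ?_)).add (cX ?_ ?_) <;> fun_prop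
  · refine (((cY ?_ ?_).sub (cY ?_ ?_)).sub (cY ?_ ?_)).add (cY ?_ ?_) <;> fun_prop

lemma dcov_eq {ρX : X → X → ℝ} {ρY : Y → Y → ℝ} (hX : IsCPM ρX) (hY : IsCPM ρY)
    (x₀ : X) (y₀ : Y) (m : Measure (X × Y)) [IsProbabilityMeasure m]
    (hu : Integrable (fun z => ρX z.1 x₀) m) (hv : Integrable (fun z => ρY z.2 y₀) m) :
    Integrable (ker6 ρX ρY) (pow6 m) ∧ dcov ρX ρY m = ∫ w, ker6 ρX ρY w ∂(pow6 m) := by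
  have hi : Integrable (ker6 ρX ρY) (pow6 m) :=
    (dom6_int m hu hv).1.mono' (continuous_ker6 hX hY).aestronglyMeasurable
      (Eventually.of_forall fun w => abs_ker6_le hX hY x₀ y₀ w)
  refine ⟨hi, ?_⟩
  unfold pow6 at hi ⊢
  rw [integral_prod _ hi]
  unfold dcov deltaTheta
  refine integral_congr_ae (Eventually.of_forall fun p => ?_)
  simp only [ker6]
  rw [(dM_eq hX m measurable_fst x₀ hu _ _).2, (dM_eq hY m measurable_snd y₀ hv _ _).2]
  exact (integral_prod_mul (μ := m.prod m) (ν := m.prod m)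
    (fun q => ker4 ρX p.1.1 p.2.1 q.1.1 q.2.1) (fun q => ker4 ρY p.1.2 p.2.2 q.1.2 q.2.2)).symm

theorem dcov_tendsto {ρX : X → X → ℝ} {ρY : Y → Y → ℝ} (hX : IsCPM ρX) (hY : IsCPM ρY)
    (x₀ : X) (y₀ : Y) (m : ℕ → ProbabilityMeasure (X × Y)) (θ : ProbabilityMeasure (X × Y))
    (hm : Tendsto m atTop (𝓝 θ))
    (hu : Integrable (fun z => ρX z.1 x₀) (θ : Measure (X × Y)))
    (hv : Integrable (fun z => ρY z.2 y₀) (θ : Measure (X × Y)))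
    (hun : ∀ n, Integrable (fun z => ρX z.1 x₀) (m n : Measure (X × Y)))
    (hvn : ∀ n, Integrable (fun z => ρY z.2 y₀) (m n : Measure (X × Y)))
    (lu : Tendsto (fun n => ∫ z, ρX z.1 x₀ ∂(m n : Measure (X × Y))) atTop
      (𝓝 (∫ z, ρX z.1 x₀ ∂(θ : Measure (X × Y)))))
    (lv : Tendsto (fun n => ∫ z, ρY z.2 y₀ ∂(m n : Measure (X × Y))) atTop
      (𝓝 (∫ z, ρY z.2 y₀ ∂(θ : Measure (X × Y))))) :
    Tendsto (fun n => dcov ρX ρY (m n : Measure (X × Y))) atTop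
      (𝓝 (dcov ρX ρY (θ : Measure (X × Y)))) := by
  have t2 : Tendsto (fun n => (m n).prod (m n)) atTop (𝓝 (θ.prod θ)) :=
    (ProbabilityMeasure.continuous_prod.tendsto (θ, θ)).comp (hm.prodMk_nhds hm)
  have t4 : Tendsto (fun n => ((m n).prod (m n)).prod ((m n).prod (m n))) atTop
      (𝓝 ((θ.prod θ).prod (θ.prod θ))) :=
    (ProbabilityMeasure.continuous_prod.tendsto (θ.prod θ, θ.prod θ)).comp (t2.prodMk_nhds t2)
  have o2 : OpensMeasurableSpace ((X × Y) × (X × Y)) := inferInstance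
  have o4 : OpensMeasurableSpace (((X × Y) × (X × Y)) × ((X × Y) × (X × Y))) := inferInstance
  have s4 : SecondCountableTopology (((X × Y) × (X × Y)) × ((X × Y) × (X × Y))) := inferInstance
  have o6 : OpensMeasurableSpace (((X × Y) × (X × Y)) × (((X × Y) × (X × Y)) × ((X × Y) × (X × Y)))) :=
    Prod.opensMeasurableSpace
  have t6 : Tendsto (fun n => ((m n).prod (m n)).prod (((m n).prod (m n)).prod ((m n).prod (m n))))
      atTop (𝓝 ((θ.prod θ).prod ((θ.prod θ).prod (θ.prod θ)))) :=
    (ProbabilityMeasure.continuous_prod.tendsto (θ.prod θ, (θ.prod θ).prod (θ.prod θ))).comp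
      (t2.prodMk_nhds t4)
  have hcu : Continuous fun z : X × Y => ρX z.1 x₀ :=
    hX.cont.comp (continuous_fst.prodMk continuous_const)
  have hcv : Continuous fun z : X × Y => ρY z.2 y₀ :=
    hY.cont.comp (continuous_snd.prodMk continuous_const)
  have hcg : Continuous (dom6 (fun z : X × Y => ρX z.1 x₀) (fun z => ρY z.2 y₀)) := by
    have a1 := hcu.comp (f := fun w : ((X × Y) × (X × Y)) × (((X × Y) × (X × Y)) × ((X × Y) × (X × Y)))
      => w.1.1) (by fun_prop)
    have a2 := hcu.comp (f := fun w : ((X × Y) × (X × Y)) × (((X × Y) × (X × Y)) × ((X × Y) × (X × Y)))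
      => w.2.1.2) (by fun_prop)
    have a3 := hcv.comp (f := fun w : ((X × Y) × (X × Y)) × (((X × Y) × (X × Y)) × ((X × Y) × (X × Y)))
      => w.1.2) (by fun_prop)
    have a4 := hcv.comp (f := fun w : ((X × Y) × (X × Y)) × (((X × Y) × (X × Y)) × ((X × Y) × (X × Y)))
      => w.2.2.1) (by fun_prop)
    exact continuous_const.mul ((((a1.mul a3).add (a1.mul a4)).add (a3.mul a2)).add (a2.mul a4))
  rw [(dcov_eq hX hY x₀ y₀ (θ : Measure (X × Y)) hu hv).2]
  simp only [fun n => (dcov_eq hX hY x₀ y₀ (m n : Measure (X × Y)) (hun n) (hvn n)).2]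
  refine tendsto_integral_of_weak t6 (continuous_ker6 hX hY) hcg (abs_ker6_le hX hY x₀ y₀)
    (fun n => (dcov_eq hX hY x₀ y₀ (m n : Measure (X × Y)) (hun n) (hvn n)).1)
    (dcov_eq hX hY x₀ y₀ (θ : Measure (X × Y)) hu hv).1
    (fun n => (dom6_int (m n : Measure (X × Y)) (hun n) (hvn n)).1)
    (dom6_int (θ : Measure (X × Y)) hu hv).1 ?_
  have := (lu.mul lv).const_mul 16
  rw [← (dom6_int (θ : Measure (X × Y)) hu hv).2] at this
  simp only [← fun n => (dom6_int (m n : Measure (X × Y)) (hun n) (hvn n)).2] at this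
  exact this

end

lemma isCPM_rpow {X : Type*} [MetricSpace X] {β : ℝ} (hβ : β ∈ Set.Ioc (0 : ℝ) 1) :
    IsCPM (fun a b : X => dist a b ^ β) where
  nonneg a b := Real.rpow_nonneg dist_nonneg _
  symm a b := by rw [dist_comm]
  tri a b c := (Real.rpow_le_rpow dist_nonneg (dist_triangle a b c) hβ.1.le).trans
    (Real.rpow_add_le_add_rpow dist_nonneg dist_nonneg hβ.1.le hβ.2)
  cont := (continuous_fst.dist continuous_snd).rpow_const fun _ => Or.inr hβ.1.le

/-- For `β ∈ (0,1]`, if `X, Y` have finite `β`-moments and `(Z_k)` is strictly stationary and ergodic, then `dcov_β(θₙ) → dcov_β(θ)` almost surely. -/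
theorem dcovBeta_strong_consistency_beta_le_one
    (β : ℝ) (hβ : β ∈ Set.Ioc (0 : ℝ) 1)
    {X Y : Type*}
    [MetricSpace X] [TopologicalSpace.SeparableSpace X] [MeasurableSpace X] [BorelSpace X]
    [MetricSpace Y] [TopologicalSpace.SeparableSpace Y] [MeasurableSpace Y] [BorelSpace Y]
    {Ω : Type*} [MeasurableSpace Ω] (P : Measure Ω) [IsProbabilityMeasure P]
    (Z : ℕ → Ω → X × Y) (hZmeas : ∀ i, Measurable (Z i))
    -- strict stationarity and ergodicity of the process
    (hstat : MeasurePreserving shift (P.map fun ω i => Z i ω) (P.map fun ω i => Z i ω))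
    (herg : Ergodic shift (P.map fun ω i => Z i ω))
    (θ : Measure (X × Y)) (hθ : θ = P.map (Z 0))
    -- finite β-moments
    (x₀ : X) (y₀ : Y)
    (hmomX : Integrable (fun x => dist x x₀ ^ (β : ℝ)) (θ.map Prod.fst))
    (hmomY : Integrable (fun y => dist y y₀ ^ (β : ℝ)) (θ.map Prod.snd)) :
    ∀ᵐ ω ∂P, Tendsto
      (fun n => dcov (fun a b : X => dist a b ^ β) (fun a b : Y => dist a b ^ β)
        (emp Z n ω))
      atTop
      (𝓝 (dcov (fun a b : X => dist a b ^ β) (fun a b : Y => dist a b ^ β) θ)) := by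
  haveI := UniformSpace.secondCountable_of_separable X
  haveI := UniformSpace.secondCountable_of_separable Y
  haveI hp : IsProbabilityMeasure (P.map (Z 0)) :=
    Measure.isProbabilityMeasure_map (hZmeas 0).aemeasurable
  have hX : IsCPM (fun a b : X => dist a b ^ β) := isCPM_rpow hβ
  have hY : IsCPM (fun a b : Y => dist a b ^ β) := isCPM_rpow hβ
  have mu0 : Measurable (fun x : X => dist x x₀ ^ β) :=
    (hX.cont.comp (continuous_id.prodMk continuous_const)).measurable
  have mv0 : Measurable (fun y : Y => dist y y₀ ^ β) :=
    (hY.cont.comp (continuous_id.prodMk continuous_const)).measurable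
  have mu : Measurable (fun z : X × Y => dist z.1 x₀ ^ β) := mu0.comp measurable_fst
  have mv : Measurable (fun z : X × Y => dist z.2 y₀ ^ β) := mv0.comp measurable_snd
  subst hθ
  rw [integrable_map_measure mu0.aestronglyMeasurable measurable_fst.aemeasurable] at hmomX
  rw [integrable_map_measure mv0.aestronglyMeasurable measurable_snd.aemeasurable] at hmomY
  filter_upwards [emp_weak P Z hZmeas herg ⟨P.map (Z 0), hp⟩ rfl,
    emp_ergodic P Z hZmeas herg mu hmomX, emp_ergodic P Z hZmeas herg mv hmomY] with ω h1 h2 h3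
  rw [← tendsto_add_atTop_iff_nat 1]
  exact dcov_tendsto hX hY x₀ y₀ (fun n => empPM Z n ω) ⟨P.map (Z 0), hp⟩ h1 hmomX hmomY
    (fun n => integrable_emp Z n ω mu) (fun n => integrable_emp Z n ω mv)
    ((tendsto_add_atTop_iff_nat 1).2 h2) ((tendsto_add_atTop_iff_nat 1).2 h3)
end
end

section
/- If (H, ‖·‖) is a separable Hilbert space, then the pseudometric space (H, ‖·‖^β) (with pseudometric (x, x') ↦ ‖x − x'‖^β) is of negative type for every β ∈ (0, 2], and of strong negative type for every β ∈ (0, 2). -/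
open MeasureTheory Filter Topology

noncomputable section

/-- A (pseudo)metric `ρ` on `X` is of negative type if there is a Hilbert space `H'` and a
map `φ : X → H'` with `ρ(x,x') = ‖φ(x) − φ(x')‖²` for all `x, x'`. -/
def IsNegativeType {X : Type*} (ρ : X → X → ℝ) : Prop :=
  ∃ (H' : Type) (_ : NormedAddCommGroup H') (_ : InnerProductSpace ℝ H')
    (_ : CompleteSpace H') (φ : X → H'), ∀ x x' : X, ρ x x' = ‖φ x - φ x'‖ ^ 2

/-- A (pseudo)metric `ρ` on `X` is of strong negative type if it is of negative type and
for all probability measures `μ₁, μ₂` with finite first `ρ`-moments,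
`D(μ₁ − μ₂) = ∫ ρ d((μ₁−μ₂)×(μ₁−μ₂)) = 0` implies `μ₁ = μ₂`.  (Here `D(μ₁ − μ₂)` is
written out as `D(μ₁) − 2∫ρ d(μ₁×μ₂) + D(μ₂)`.) -/
def IsStrongNegativeType {X : Type*} [MeasurableSpace X] (ρ : X → X → ℝ) : Prop :=
  IsNegativeType ρ ∧
  ∀ (μ₁ μ₂ : Measure X), IsProbabilityMeasure μ₁ → IsProbabilityMeasure μ₂ →
    (∃ x₀, Integrable (fun x => ρ x x₀) μ₁) → (∃ x₀, Integrable (fun x => ρ x x₀) μ₂) →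
    (∫ p : X × X, ρ p.1 p.2 ∂(μ₁.prod μ₁)) - 2 * (∫ p : X × X, ρ p.1 p.2 ∂(μ₁.prod μ₂))
      + (∫ p : X × X, ρ p.1 p.2 ∂(μ₂.prod μ₂)) = 0 →
    μ₁ = μ₂


lemma exists_feature.{u} {X : Type u} (k : Matrix X X ℝ) (hk : k.PosSemidef) :
    ∃ (H' : Type u) (_ : NormedAddCommGroup H') (_ : InnerProductSpace ℝ H')
    (_ : CompleteSpace H') (φ : X → H'), ∀ x y, inner ℝ (φ x) (φ y) = k x y := by
  let K : Matrix X X (ℝ →L[ℝ] ℝ) := Matrix.of fun x y => k x y • ContinuousLinearMap.id ℝ ℝ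
  have hsymm : ∀ x y, k x y = k y x := fun x y => by
    have := hk.isHermitian.apply y x
    simpa using this
  have hK : K.PosSemidef := by
    refine ((RKHS.posSemidef_tfae (K := K)).out 0 2).mpr ?_
    refine ⟨?_, fun vv => ?_⟩
    · ext x y
      have h1 : star (ContinuousLinearMap.id ℝ ℝ) = ContinuousLinearMap.id ℝ ℝ :=
        star_one (ℝ →L[ℝ] ℝ)
      simp [K, hsymm x y, Matrix.conjTranspose_apply, h1]
    · have := hk.2 vv
      simp only [K, Matrix.of_apply, Finsupp.sum, star_trivial, RCLike.re_to_real] at this ⊢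
      refine this.trans_eq (Finset.sum_congr rfl fun x _ => Finset.sum_congr rfl fun y _ => ?_)
      simp [hsymm x y]
      ring
  have : Fact K.PosSemidef := ⟨hK⟩
  refine ⟨RKHS.OfKernel K, inferInstance, inferInstance, inferInstance,
    fun x => RKHS.kerFun (RKHS.OfKernel K) x (1 : ℝ), fun x y => ?_⟩
  rw [← RKHS.kernel_inner, RKHS.OfKernel.kernel_ofKernel]
  simp [K, hsymm x y]

/-- Transfer of a separable Hilbert space to universe zero. -/
lemma exists_type_zero (H : Type*) [NormedAddCommGroup H] [InnerProductSpace ℝ H] [CompleteSpace H]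
    [TopologicalSpace.SeparableSpace H] :
    ∃ (E : Type) (_ : NormedAddCommGroup E) (_ : InnerProductSpace ℝ E)
    (_ : CompleteSpace E), Nonempty (H ≃ₗᵢ[ℝ] E) := by
  obtain ⟨w, b, hb⟩ := exists_hilbertBasis ℝ H
  have hcount : w.Countable := by
    refine Set.PairwiseDisjoint.countable_of_isOpen (s := fun x : H => Metric.ball x (1/2)) ?_
      (fun i _ => Metric.isOpen_ball) (fun i _ => ⟨i, by simp⟩)
    intro x hx y hy hxy
    refine Metric.ball_disjoint_ball ?_
    have ho := b.orthonormal
    rw [hb] at ho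
    have h1 : ‖x‖ = 1 := ho.1 ⟨x, hx⟩
    have h2 : ‖y‖ = 1 := ho.1 ⟨y, hy⟩
    have h3 : inner ℝ x y = 0 := ho.2 (i := ⟨x, hx⟩) (j := ⟨y, hy⟩) (by simpa using hxy)
    have h4 : ‖x - y‖ ^ 2 = 2 := by
      rw [norm_sub_sq_real, h1, h2, h3]; norm_num
    rw [dist_eq_norm]
    nlinarith [norm_nonneg (x - y)]
  have : Countable w := hcount
  obtain ⟨f, hf⟩ := exists_injective_nat w
  let e : w ≃ Set.range f := Equiv.ofInjective f hf
  have ho : Orthonormal ℝ (b ∘ e.symm) := b.orthonormal.comp _ e.symm.injective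
  have hsp : ⊤ ≤ (Submodule.span ℝ (Set.range (b ∘ e.symm))).topologicalClosure := by
    rw [EquivLike.range_comp, b.dense_span]
  let b' := HilbertBasis.mk ho hsp
  exact ⟨_, _, _, inferInstance, ⟨b'.repr⟩⟩

lemma posSemidef_inner (H : Type*) [NormedAddCommGroup H] [InnerProductSpace ℝ H] {X : Type*}
    (φ : X → H) : (Matrix.of fun x y : X => inner ℝ (φ x) (φ y)).PosSemidef := by
  refine ⟨?_, fun c => ?_⟩
  · ext x y
    simp [real_inner_comm]
  · have : 0 ≤ inner ℝ (∑ x ∈ c.support, c x • φ x) (∑ x ∈ c.support, c x • φ x) :=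
      real_inner_self_nonneg
    simp only [sum_inner, inner_sum, real_inner_smul_left, real_inner_smul_right] at this
    simp only [Finsupp.sum, Matrix.of_apply, star_trivial]
    refine this.trans_eq (Finset.sum_congr rfl fun x _ => Finset.sum_congr rfl fun y _ => ?_)
    rw [real_inner_comm]
    ring

lemma posSemidef_pow (H : Type*) [NormedAddCommGroup H] [InnerProductSpace ℝ H] (n : ℕ) :
    (Matrix.of fun x y : H => (inner ℝ x y : ℝ) ^ n).PosSemidef := by
  induction n with
  | zero => simpa using posSemidef_inner ℝ (fun _ : H => (1 : ℝ))
  | succ n ih =>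
    have := ih.hadamard (posSemidef_inner H (fun x : H => x))
    have e : (Matrix.of fun x y : H => (inner ℝ x y : ℝ) ^ (n + 1)) =
        (Matrix.of fun x y : H => (inner ℝ x y : ℝ) ^ n).hadamard
          (Matrix.of fun x y : H => inner ℝ x y) := by
      ext x y
      simp [pow_succ]
    rw [e]
    exact this

lemma posSemidef_gauss (H : Type*) [NormedAddCommGroup H] [InnerProductSpace ℝ H] {t : ℝ}
    (ht : 0 ≤ t) :
    (Matrix.of fun x y : H => Real.exp (-t * ‖x - y‖ ^ 2)).PosSemidef := by
  have h1 : (Matrix.of fun x y : H => Real.exp (2 * t * inner ℝ x y)).PosSemidef := by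
    refine ⟨?_, fun c => ?_⟩
    · ext x y
      simp [real_inner_comm]
    · simp only [Finsupp.sum, Matrix.of_apply, star_trivial]
      have hs : HasSum (fun n : ℕ => ∑ x ∈ c.support, ∑ y ∈ c.support,
          c x * ((2 * t * inner ℝ x y) ^ n / n.factorial) * c y)
          (∑ x ∈ c.support, ∑ y ∈ c.support, c x * Real.exp (2 * t * inner ℝ x y) * c y) := by
        refine hasSum_sum fun x _ => hasSum_sum fun y _ => ?_
        refine ((HasSum.mul_left _ ?_).mul_right _)
        rw [Real.exp_eq_exp_ℝ]
        exact NormedSpace.expSeries_div_hasSum_exp (𝔸 := ℝ) _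
      refine hs.nonneg fun n => ?_
      have h2 := (posSemidef_pow H n).2 c
      simp only [Finsupp.sum, Matrix.of_apply, star_trivial] at h2
      have h3 : 0 ≤ (2 * t) ^ n / n.factorial := by positivity
      refine (mul_nonneg h3 h2).trans_eq ?_
      simp only [Finset.mul_sum]
      refine (Finset.sum_congr rfl fun x _ => Finset.sum_congr rfl fun y _ => ?_)
      rw [mul_pow]; ring
  have h2 := (posSemidef_inner ℝ (fun x : H => Real.exp (-t * ‖x‖ ^ 2))).hadamard h1
  suffices e : (Matrix.of fun x y : H => Real.exp (-t * ‖x - y‖ ^ 2)) =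
      (Matrix.of fun x y : H => inner ℝ (Real.exp (-t * ‖x‖ ^ 2))
        (Real.exp (-t * ‖y‖ ^ 2))).hadamard
        (Matrix.of fun x y => Real.exp (2 * t * inner ℝ x y)) from by
    rw [e]
    exact h2
  ext x y
  simp only [Matrix.of_apply, Matrix.hadamard_apply, RCLike.inner_apply, conj_trivial,
    ← Real.exp_add]
  congr 1
  rw [norm_sub_sq_real]; ring


/-- weight -/
def wfun (β : ℝ) (t : ℝ) : ℝ := t ^ (-1 - β / 2)

lemma integrable_base {β : ℝ} (h0 : 0 < β) (h2 : β < 2) :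
    IntegrableOn (fun t => wfun β t * (1 - Real.exp (-t))) (Set.Ioi 0) := by
  have hm : ∀ s : Set ℝ, AEStronglyMeasurable (fun t => wfun β t * (1 - Real.exp (-t)))
      (volume.restrict s) := fun s => by
    unfold wfun
    exact Measurable.aestronglyMeasurable (by fun_prop)
  rw [← Set.Ioc_union_Ioi_eq_Ioi (zero_le_one (α := ℝ))]
  refine IntegrableOn.union ?_ ?_
  · have h : IntegrableOn (fun t : ℝ => t ^ (-(β / 2))) (Set.Ioc 0 1) := by
      rw [← intervalIntegrable_iff_integrableOn_Ioc_of_le zero_le_one]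
      exact intervalIntegral.intervalIntegrable_rpow' (by linarith)
    refine h.mono' (hm _) ?_
    refine (ae_restrict_iff' measurableSet_Ioc).mpr (.of_forall fun t ht => ?_)
    have h1 : 0 ≤ 1 - Real.exp (-t) := by
      have := Real.exp_le_one_iff.mpr (by linarith [ht.1] : -t ≤ 0)
      linarith
    have h3 : 1 - Real.exp (-t) ≤ t := by linarith [Real.add_one_le_exp (-t)]
    have h4 : 0 ≤ wfun β t := Real.rpow_nonneg ht.1.le _
    rw [Real.norm_of_nonneg (mul_nonneg h4 h1)]
    calc wfun β t * (1 - Real.exp (-t)) ≤ wfun β t * t := by gcongr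
      _ = t ^ (-(β / 2)) := by
        unfold wfun
        rw [← Real.rpow_add_one ht.1.ne']
        congr 1; ring
  · have h : IntegrableOn (fun t : ℝ => t ^ (-1 - β / 2)) (Set.Ioi 1) :=
      integrableOn_Ioi_rpow_of_lt (by linarith) one_pos
    refine h.mono' (hm _) ?_
    refine (ae_restrict_iff' measurableSet_Ioi).mpr (.of_forall fun t ht => ?_)
    have ht : 1 < t := ht
    have h1 : 0 ≤ 1 - Real.exp (-t) := by
      have := Real.exp_le_one_iff.mpr (by linarith : -t ≤ 0)
      linarith
    have h4 : 0 ≤ wfun β t := Real.rpow_nonneg (by linarith) _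
    rw [Real.norm_of_nonneg (mul_nonneg h4 h1)]
    calc wfun β t * (1 - Real.exp (-t)) ≤ wfun β t * 1 := by
          gcongr; linarith [Real.exp_pos (-t)]
      _ = _ := mul_one _

/-- constant -/
def cst (β : ℝ) : ℝ := ∫ t in Set.Ioi (0 : ℝ), wfun β t * (1 - Real.exp (-t))

lemma cst_pos {β : ℝ} (h0 : 0 < β) (h2 : β < 2) : 0 < cst β := by
  have hp : ∀ t ∈ Set.Ioi (0 : ℝ), 0 < wfun β t * (1 - Real.exp (-t)) := fun t ht => by
    have ht : 0 < t := ht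
    have h1 : 0 < 1 - Real.exp (-t) := by
      have := Real.exp_lt_one_iff.mpr (by linarith : -t < 0)
      linarith
    exact mul_pos (Real.rpow_pos_of_pos ht _) h1
  unfold cst
  rw [setIntegral_pos_iff_support_of_nonneg_ae _ (integrable_base h0 h2)]
  · rw [Set.inter_eq_self_of_subset_right (show Set.Ioi (0 : ℝ) ⊆ Function.support _ from fun t ht => (hp t ht).ne')]
    simp
  · exact (ae_restrict_iff' measurableSet_Ioi).mpr (.of_forall fun t ht => (hp t ht).le)

lemma scaled {β r : ℝ} (h0 : 0 < β) (h2 : β < 2) (hr : 0 ≤ r) :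
    IntegrableOn (fun t => wfun β t * (1 - Real.exp (-t * r ^ 2))) (Set.Ioi 0) ∧
    ∫ t in Set.Ioi (0 : ℝ), wfun β t * (1 - Real.exp (-t * r ^ 2)) = cst β * r ^ β := by
  rcases hr.eq_or_lt with rfl | hr
  · simp [Real.zero_rpow h0.ne']
  have hr2 : 0 < r ^ 2 := by positivity
  have key : ∀ t ∈ Set.Ioi (0 : ℝ), wfun β t * (1 - Real.exp (-t * r ^ 2)) =
      (r ^ 2) ^ (1 + β / 2) * (wfun β (r ^ 2 * t) * (1 - Real.exp (-(r ^ 2 * t)))) := by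
    intro t ht
    unfold wfun
    rw [Real.mul_rpow hr2.le (le_of_lt ht), ← mul_assoc, ← mul_assoc, ← Real.rpow_add hr2]
    simp only [show 1 + β / 2 + (-1 - β / 2) = 0 by ring, Real.rpow_zero, one_mul]
    congr 3
    ring_nf
  constructor
  · refine IntegrableOn.congr_fun ?_ (fun t ht => (key t ht).symm) measurableSet_Ioi
    refine Integrable.const_mul ?_ _
    have := (integrableOn_Ioi_comp_mul_left_iff
      (fun t => wfun β t * (1 - Real.exp (-t))) 0 hr2).mpr
    rw [mul_zero] at this
    exact this (integrable_base h0 h2)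
  · rw [setIntegral_congr_fun measurableSet_Ioi key, integral_const_mul,
      integral_comp_mul_left_Ioi (fun t => wfun β t * (1 - Real.exp (-t))) 0 hr2, mul_zero,
      smul_eq_mul, ← mul_assoc, mul_comm, cst]
    congr 1
    rw [← Real.rpow_neg_one, ← Real.rpow_add hr2, ← Real.rpow_natCast, ← Real.rpow_mul hr.le]
    congr 1
    push_cast; ring


lemma negType_of_lt {E : Type*} [NormedAddCommGroup E] [InnerProductSpace ℝ E] {β : ℝ}
    (h0 : 0 < β) (h2 : β < 2) :
    (Matrix.of fun x y : E => (‖x‖ ^ β + ‖y‖ ^ β - ‖x - y‖ ^ β) / 2).PosSemidef := by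
  refine ⟨?_, fun c => ?_⟩
  · ext x y
    simp only [Matrix.conjTranspose_apply, Matrix.of_apply, star_trivial, norm_sub_rev x y]
    ring
  simp only [Finsupp.sum, Matrix.of_apply, star_trivial]
  let G : E → E → ℝ → ℝ := fun x y t =>
    wfun β t * (1 - Real.exp (-t * ‖x‖ ^ 2)) + wfun β t * (1 - Real.exp (-t * ‖y‖ ^ 2))
      - wfun β t * (1 - Real.exp (-t * ‖x - y‖ ^ 2))
  have hG : ∀ x y, IntegrableOn (G x y) (Set.Ioi 0) := fun x y =>
    ((scaled h0 h2 (norm_nonneg x)).1.add (scaled h0 h2 (norm_nonneg y)).1).sub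
      (scaled h0 h2 (norm_nonneg (x - y))).1
  have hGi : ∀ x y, ∫ t in Set.Ioi (0 : ℝ), G x y t
      = cst β * (‖x‖ ^ β + ‖y‖ ^ β - ‖x - y‖ ^ β) := fun x y => by
    have e1 := integral_sub ((scaled h0 h2 (norm_nonneg x)).1.add
      (scaled h0 h2 (norm_nonneg y)).1) (scaled h0 h2 (norm_nonneg (x - y))).1
    have e2 := integral_add (scaled h0 h2 (norm_nonneg x)).1 (scaled h0 h2 (norm_nonneg y)).1
    simp only [(scaled h0 h2 (norm_nonneg _)).2, Pi.add_apply] at e1 e2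
    simp only [G]
    rw [e1, e2]; ring
  have hpos : 0 ≤ ∫ t in Set.Ioi (0 : ℝ), ∑ x ∈ c.support, ∑ y ∈ c.support,
      c x * G x y t * c y := by
    refine setIntegral_nonneg measurableSet_Ioi fun t ht => ?_
    have ht : 0 < t := ht
    obtain ⟨H', _, _, _, φ, hφ⟩ := exists_feature _ (posSemidef_gauss E ht.le)
    have hp := (posSemidef_inner H' (fun x => φ x - φ 0)).2 c
    simp only [Finsupp.sum, Matrix.of_apply, star_trivial] at hp
    have hw : 0 ≤ wfun β t := Real.rpow_nonneg ht.le _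
    refine (mul_nonneg hw hp).trans_eq ?_
    simp only [Finset.mul_sum]
    refine (Finset.sum_congr rfl fun x _ => Finset.sum_congr rfl fun y _ => ?_)
    simp only [inner_sub_left, inner_sub_right, hφ, Matrix.of_apply, G, sub_zero, zero_sub,
      norm_neg, norm_zero]
    simp
    ring
  rw [integral_finsetSum _ (fun x _ => integrable_finsetSum _ fun y _ =>
    ((hG x y).const_mul _).mul_const _)] at hpos
  have e : ∀ x ∈ c.support, ∫ t in Set.Ioi (0 : ℝ), ∑ y ∈ c.support, c x * G x y t * c y
      = ∑ y ∈ c.support, c x * (cst β * (‖x‖ ^ β + ‖y‖ ^ β - ‖x - y‖ ^ β)) * c y := by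
    intro x _
    rw [integral_finsetSum _ (fun y _ => ((hG x y).const_mul _).mul_const _)]
    refine Finset.sum_congr rfl fun y _ => ?_
    rw [integral_mul_const, integral_const_mul, hGi]
  rw [Finset.sum_congr rfl e] at hpos
  have hc := cst_pos h0 h2
  refine (mul_nonneg (by positivity : 0 ≤ (2 * cst β)⁻¹) hpos).trans_eq ?_
  simp only [Finset.mul_sum]
  refine (Finset.sum_congr rfl fun x _ => Finset.sum_congr rfl fun y _ => ?_)
  field_simp

lemma isNegativeType_of_mem {H : Type*} [NormedAddCommGroup H] [InnerProductSpace ℝ H]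
    [CompleteSpace H] [TopologicalSpace.SeparableSpace H] {β : ℝ} (h0 : 0 < β) (h2 : β ≤ 2) :
    IsNegativeType (fun x x' : H => ‖x - x'‖ ^ β) := by
  obtain ⟨E, _, _, _, ⟨e⟩⟩ := exists_type_zero H
  rcases h2.eq_or_lt with rfl | h2
  · refine ⟨E, inferInstance, inferInstance, inferInstance, e, fun x y => ?_⟩
    rw [← map_sub, e.norm_map]
    simp
  · obtain ⟨H', _, _, _, φ, hφ⟩ := exists_feature _ (negType_of_lt (E := E) h0 h2)
    refine ⟨H', inferInstance, inferInstance, inferInstance, fun x => φ (e x), fun x y => ?_⟩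
    rw [norm_sub_sq_real, ← real_inner_self_eq_norm_sq, ← real_inner_self_eq_norm_sq]
    simp only [hφ, Matrix.of_apply, sub_self, norm_zero, Real.zero_rpow h0.ne', ← map_sub,
      e.norm_map]
    ring

section strong

set_option linter.unusedSectionVars false

variable {H : Type*} [NormedAddCommGroup H] [InnerProductSpace ℝ H] [CompleteSpace H]
    [TopologicalSpace.SeparableSpace H] [MeasurableSpace H] [BorelSpace H]

lemma integrable_rho (β : ℝ) (h0 : 0 < β) (μ₁ μ₂ : Measure H) [IsProbabilityMeasure μ₁]
    [IsProbabilityMeasure μ₂] (h1 : ∃ x₀, Integrable (fun x => ‖x - x₀‖ ^ β) μ₁)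
    (h2 : ∃ x₀, Integrable (fun x => ‖x - x₀‖ ^ β) μ₂) :
    Integrable (fun p : H × H => ‖p.1 - p.2‖ ^ β) (μ₁.prod μ₂) := by
  have : SecondCountableTopology H := UniformSpace.secondCountable_of_separable H
  obtain ⟨x₀, h1⟩ := h1
  obtain ⟨y₀, h2⟩ := h2
  have hb : Integrable (fun p : H × H => 3 ^ β * (‖p.1 - x₀‖ ^ β + ‖p.2 - y₀‖ ^ β
      + ‖x₀ - y₀‖ ^ β)) (μ₁.prod μ₂) :=
    (((h1.comp_fst μ₂).add (h2.comp_snd μ₁)).add (integrable_const _)).const_mul _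
  refine hb.mono' ?_ (.of_forall fun p => ?_)
  · exact (Continuous.rpow_const (by fun_prop) (fun _ => Or.inr h0.le)).aestronglyMeasurable
  · rw [Real.norm_of_nonneg (by positivity)]
    have htri : ‖p.1 - p.2‖ ≤ ‖p.1 - x₀‖ + ‖p.2 - y₀‖ + ‖x₀ - y₀‖ := by
      have e : p.1 - p.2 = (p.1 - x₀) - (p.2 - y₀) + (x₀ - y₀) := by abel
      rw [e]
      exact (norm_add_le _ _).trans (by gcongr; exact norm_sub_le _ _)
    have key : ∀ a b c : ℝ, 0 ≤ a → 0 ≤ b → 0 ≤ c →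
        (a + b + c) ^ β ≤ 3 ^ β * (a ^ β + b ^ β + c ^ β) := by
      intro a b c ha hb hc
      have hA := Real.rpow_nonneg ha β
      have hB := Real.rpow_nonneg hb β
      have hC := Real.rpow_nonneg hc β
      have : ∀ m, 0 ≤ m → a + b + c ≤ 3 * m → m ^ β ≤ a ^ β + b ^ β + c ^ β →
          (a + b + c) ^ β ≤ 3 ^ β * (a ^ β + b ^ β + c ^ β) := by
        intro m hm h1 h2
        calc (a + b + c) ^ β ≤ (3 * m) ^ β := by gcongr
          _ = 3 ^ β * m ^ β := Real.mul_rpow (by norm_num) hm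
          _ ≤ _ := by gcongr
      rcases le_total a b with h | h <;> rcases le_total b c with h' | h' <;>
        rcases le_total a c with h'' | h''
      all_goals first
        | exact this a ha (by linarith) (by linarith)
        | exact this b hb (by linarith) (by linarith)
        | exact this c hc (by linarith) (by linarith)
    exact (Real.rpow_le_rpow (norm_nonneg _) htri h0.le).trans
      (key _ _ _ (norm_nonneg _) (norm_nonneg _) (norm_nonneg _))

lemma fubini_rho {β : ℝ} (h0 : 0 < β) (h2 : β < 2) (μ₁ μ₂ : Measure H) [IsProbabilityMeasure μ₁]
    [IsProbabilityMeasure μ₂]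
    (h : Integrable (fun p : H × H => ‖p.1 - p.2‖ ^ β) (μ₁.prod μ₂)) :
    IntegrableOn (fun t => wfun β t *
      (1 - ∫ p : H × H, Real.exp (-t * ‖p.1 - p.2‖ ^ 2) ∂(μ₁.prod μ₂))) (Set.Ioi 0) ∧
    ∫ t in Set.Ioi (0 : ℝ), wfun β t *
      (1 - ∫ p : H × H, Real.exp (-t * ‖p.1 - p.2‖ ^ 2) ∂(μ₁.prod μ₂)) =
      cst β * ∫ p : H × H, ‖p.1 - p.2‖ ^ β ∂(μ₁.prod μ₂) := by
  have : SecondCountableTopology H := UniformSpace.secondCountable_of_separable H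
  let F : (H × H) × ℝ → ℝ := fun q => wfun β q.2 * (1 - Real.exp (-q.2 * ‖q.1.1 - q.1.2‖ ^ 2))
  have hF : Integrable F ((μ₁.prod μ₂).prod (volume.restrict (Set.Ioi (0 : ℝ)))) := by
    refine (integrable_prod_iff ?_).mpr ⟨.of_forall fun p => ?_, ?_⟩
    · refine Measurable.aestronglyMeasurable ?_
      simp only [F, wfun]
      fun_prop
    · exact (scaled h0 h2 (norm_nonneg (p.1 - p.2))).1
    · have : ∀ p : H × H, ∫ t in Set.Ioi (0 : ℝ), ‖F (p, t)‖ = cst β * ‖p.1 - p.2‖ ^ β := by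
        intro p
        rw [← (scaled h0 h2 (norm_nonneg (p.1 - p.2))).2]
        refine setIntegral_congr_fun measurableSet_Ioi fun t ht => ?_
        have ht : 0 < t := ht
        refine Real.norm_of_nonneg (mul_nonneg (Real.rpow_nonneg ht.le _) ?_)
        have : Real.exp (-t * ‖p.1 - p.2‖ ^ 2) ≤ 1 :=
          Real.exp_le_one_iff.mpr (by nlinarith [sq_nonneg ‖p.1 - p.2‖])
        linarith
      simp only [this]
      exact h.const_mul _
  have e : ∀ t ∈ Set.Ioi (0 : ℝ), ∫ p, F (p, t) ∂(μ₁.prod μ₂) = wfun β t *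
      (1 - ∫ p : H × H, Real.exp (-t * ‖p.1 - p.2‖ ^ 2) ∂(μ₁.prod μ₂)) := by
    intro t ht
    have ht : 0 < t := ht
    have hi : Integrable (fun p : H × H => Real.exp (-t * ‖p.1 - p.2‖ ^ 2)) (μ₁.prod μ₂) := by
      refine Integrable.of_bound (Continuous.aestronglyMeasurable (by fun_prop)) 1
        (.of_forall fun p => ?_)
      rw [Real.norm_of_nonneg (Real.exp_pos _).le]
      exact Real.exp_le_one_iff.mpr (by nlinarith [sq_nonneg ‖p.1 - p.2‖])
    simp only [F]
    rw [integral_const_mul, integral_sub (integrable_const _) hi]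
    simp
  constructor
  · exact IntegrableOn.congr_fun hF.integral_prod_right e measurableSet_Ioi
  · rw [← setIntegral_congr_fun measurableSet_Ioi e, ← integral_const_mul]
    have := integral_integral_swap (f := fun p t => F (p, t)) hF
    rw [← this]
    refine integral_congr_ae (.of_forall fun p => ?_)
    exact (scaled h0 h2 (norm_nonneg (p.1 - p.2))).2

lemma mean_embedding {t : ℝ} (ht : 0 < t) (μ₁ μ₂ : Measure H) [IsProbabilityMeasure μ₁]
    [IsProbabilityMeasure μ₂] :
    0 ≤ (∫ p : H × H, Real.exp (-t * ‖p.1 - p.2‖ ^ 2) ∂(μ₁.prod μ₁))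
      - 2 * (∫ p : H × H, Real.exp (-t * ‖p.1 - p.2‖ ^ 2) ∂(μ₁.prod μ₂))
      + (∫ p : H × H, Real.exp (-t * ‖p.1 - p.2‖ ^ 2) ∂(μ₂.prod μ₂)) ∧
    ((∫ p : H × H, Real.exp (-t * ‖p.1 - p.2‖ ^ 2) ∂(μ₁.prod μ₁))
      - 2 * (∫ p : H × H, Real.exp (-t * ‖p.1 - p.2‖ ^ 2) ∂(μ₁.prod μ₂))
      + (∫ p : H × H, Real.exp (-t * ‖p.1 - p.2‖ ^ 2) ∂(μ₂.prod μ₂)) = 0 →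
      ∀ y : H, ∫ x, Real.exp (-t * ‖x - y‖ ^ 2) ∂μ₁ = ∫ x, Real.exp (-t * ‖x - y‖ ^ 2) ∂μ₂) := by
  have : SecondCountableTopology H := UniformSpace.secondCountable_of_separable H
  obtain ⟨H', _, _, _, φ, hφ⟩ := exists_feature _ (posSemidef_gauss H ht.le)
  simp only [Matrix.of_apply] at hφ
  have hn : ∀ x, ‖φ x‖ = 1 := fun x => by
    have h1 : ‖φ x‖ ^ 2 = 1 := by
      rw [← real_inner_self_eq_norm_sq, hφ]; simp
    nlinarith [norm_nonneg (φ x)]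
  have hcont : Continuous φ := by
    refine continuous_iff_continuousAt.mpr fun x => tendsto_iff_norm_sub_tendsto_zero.mpr ?_
    have e : ∀ y, ‖φ y - φ x‖ = Real.sqrt (2 - 2 * Real.exp (-t * ‖y - x‖ ^ 2)) := fun y => by
      rw [← Real.sqrt_sq (norm_nonneg (φ y - φ x)), norm_sub_sq_real, hφ, hn, hn]
      congr 1; ring
    simp only [e]
    have hc : Continuous (fun y => Real.sqrt (2 - 2 * Real.exp (-t * ‖y - x‖ ^ 2))) := by
      fun_prop
    have := hc.tendsto x
    simpa using this
  have hint : ∀ (μ : Measure H) [IsProbabilityMeasure μ], Integrable φ μ := fun μ _ =>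
    Integrable.of_bound hcont.aestronglyMeasurable 1 (.of_forall fun x => (hn x).le)
  have hin : ∀ (μ : Measure H) [IsProbabilityMeasure μ] (y : H),
      inner ℝ (∫ x, φ x ∂μ) (φ y) = ∫ x, Real.exp (-t * ‖x - y‖ ^ 2) ∂μ := by
    intro μ _ y
    rw [real_inner_comm, ← integral_inner (hint μ)]
    refine integral_congr_ae (.of_forall fun x => ?_)
    simp only [hφ, norm_sub_rev]
  have hin2 : ∀ (μ ν : Measure H) [IsProbabilityMeasure μ] [IsProbabilityMeasure ν],
      inner ℝ (∫ x, φ x ∂μ) (∫ x, φ x ∂ν) =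
        ∫ p : H × H, Real.exp (-t * ‖p.1 - p.2‖ ^ 2) ∂(μ.prod ν) := by
    intro μ ν _ _
    have hi : Integrable (fun p : H × H => Real.exp (-t * ‖p.1 - p.2‖ ^ 2)) (μ.prod ν) := by
      refine Integrable.of_bound (Continuous.aestronglyMeasurable (by fun_prop)) 1
        (.of_forall fun p => ?_)
      rw [Real.norm_of_nonneg (Real.exp_pos _).le]
      exact Real.exp_le_one_iff.mpr (by nlinarith [sq_nonneg ‖p.1 - p.2‖])
    rw [integral_prod_symm _ hi, ← integral_inner (hint ν)]
    refine integral_congr_ae (.of_forall fun y => ?_)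
    exact hin μ y
  rw [← hin2, ← hin2, ← hin2]
  have e : inner ℝ (∫ x, φ x ∂μ₁) (∫ x, φ x ∂μ₁) - 2 * inner ℝ (∫ x, φ x ∂μ₁) (∫ x, φ x ∂μ₂)
      + inner ℝ (∫ x, φ x ∂μ₂) (∫ x, φ x ∂μ₂) = ‖(∫ x, φ x ∂μ₁) - ∫ x, φ x ∂μ₂‖ ^ 2 := by
    rw [norm_sub_sq_real, real_inner_self_eq_norm_sq, real_inner_self_eq_norm_sq]
  rw [e]
  refine ⟨by positivity, fun h y => ?_⟩
  have h' : (∫ x, φ x ∂μ₁) = ∫ x, φ x ∂μ₂ := by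
    rw [← sub_eq_zero, ← norm_eq_zero]
    exact pow_eq_zero_iff two_ne_zero |>.mp h
  rw [← hin, ← hin, h']

lemma eq_of_gauss {t : ℝ} (ht : 0 < t) (μ₁ μ₂ : Measure H) [IsProbabilityMeasure μ₁]
    [IsProbabilityMeasure μ₂]
    (h : ∀ y : H, ∫ x, Real.exp (-t * ‖x - y‖ ^ 2) ∂μ₁ = ∫ x, Real.exp (-t * ‖x - y‖ ^ 2) ∂μ₂) :
    μ₁ = μ₂ := by
  have : SecondCountableTopology H := UniformSpace.secondCountable_of_separable H
  let f : H → ENNReal := fun x => ENNReal.ofReal (Real.exp (-t * ‖x‖ ^ 2))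
  have hfm : Measurable f := by fun_prop
  have hf0 : ∀ x, f x ≠ 0 := fun x => by
    simp only [f, ne_eq, ENNReal.ofReal_eq_zero, not_le]; exact Real.exp_pos _
  have hft : ∀ x, f x ≠ ⊤ := fun x => ENNReal.ofReal_ne_top
  have hex : ∀ (x y : H), Real.exp (-t * ‖x‖ ^ 2) * Real.exp (2 * t * inner ℝ x y) =
      Real.exp (t * ‖y‖ ^ 2) * Real.exp (-t * ‖x - y‖ ^ 2) := fun x y => by
    rw [← Real.exp_add, ← Real.exp_add, norm_sub_sq_real]
    congr 1; ring
  have hgi : ∀ (μ : Measure H) [IsProbabilityMeasure μ] (y : H),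
      Integrable (fun x => Real.exp (-t * ‖x - y‖ ^ 2)) μ := by
    intro μ _ y
    refine Integrable.of_bound (Continuous.aestronglyMeasurable (by fun_prop)) 1
      (.of_forall fun p => ?_)
    rw [Real.norm_of_nonneg (Real.exp_pos _).le]
    exact Real.exp_le_one_iff.mpr (by nlinarith [sq_nonneg ‖p - y‖])
  have hr : ∀ x, (f x).toReal = Real.exp (-t * ‖x‖ ^ 2) := fun x =>
    ENNReal.toReal_ofReal (Real.exp_pos _).le
  have hinn : ∀ (s : ℝ) (x y : H), s * inner ℝ x y = 2 * t * inner ℝ x ((s / (2 * t)) • y) := by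
    intro s x y
    rw [real_inner_smul_right]; field_simp
  have hfin : ∀ (μ : Measure H) [IsProbabilityMeasure μ], IsFiniteMeasure (μ.withDensity f) := by
    intro μ _
    have := hgi μ 0
    simp only [sub_zero] at this
    exact isFiniteMeasure_withDensity_ofReal this.2
  have hI : ∀ (μ : Measure H) [IsProbabilityMeasure μ] (y : H),
      ProbabilityTheory.integrableExpSet (fun x => inner ℝ x y) (μ.withDensity f) = Set.univ := by
    intro μ _ y
    refine Set.eq_univ_of_forall fun s => ?_
    change Integrable _ _
    rw [integrable_withDensity_iff hfm (.of_forall fun x => (hft x).lt_top)]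
    simp only [hr, hinn s]
    simp only [mul_comm _ (Real.exp (-t * _)), hex]
    exact (hgi μ _).mul_const _
  have hmgf : ∀ y : H, ProbabilityTheory.mgf (fun x => inner ℝ x y) (μ₁.withDensity f) =
      ProbabilityTheory.mgf (fun x => inner ℝ x y) (μ₂.withDensity f) := by
    intro y
    ext s
    have key : ∀ (μ : Measure H) [IsProbabilityMeasure μ],
        ProbabilityTheory.mgf (fun x => inner ℝ x y) (μ.withDensity f) s =
        Real.exp (t * ‖(s / (2 * t)) • y‖ ^ 2) *
          ∫ x, Real.exp (-t * ‖x - (s / (2 * t)) • y‖ ^ 2) ∂μ := by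
      intro μ _
      unfold ProbabilityTheory.mgf
      rw [integral_withDensity_eq_integral_toReal_smul hfm
        (.of_forall fun x => (hft x).lt_top), ← integral_const_mul]
      simp only [hr, hinn s, smul_eq_mul, hex]
    rw [key, key, h]
  have := hfin μ₁
  have := hfin μ₂
  have hz : μ₁.withDensity f = 0 ↔ μ₂.withDensity f = 0 := by
    have hne : ∀ (μ : Measure H) [IsProbabilityMeasure μ], μ.withDensity f ≠ 0 := by
      intro μ _ h0
      have h1 := withDensity_inv_same (μ := μ) hfm (.of_forall hf0) (.of_forall hft)
      rw [h0] at h1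
      exact IsProbabilityMeasure.ne_zero μ (by simpa using h1.symm)
    exact iff_of_false (hne μ₁) (hne μ₂)
  have heq : μ₁.withDensity f = μ₂.withDensity f := by
    refine Measure.ext_of_charFun (funext fun y => ?_)
    have := ProbabilityTheory.eqOn_complexMGF_of_mgf' (hmgf y) hz
      (x := Complex.I) (by simp [hI])
    simp only [ProbabilityTheory.complexMGF] at this
    simp only [charFun_apply]
    simpa only [mul_comm] using this
  rw [← withDensity_inv_same (μ := μ₁) hfm (.of_forall hf0) (.of_forall hft), heq,
    withDensity_inv_same (μ := μ₂) hfm (.of_forall hf0) (.of_forall hft)]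

lemma strong_aux {β : ℝ} (h0 : 0 < β) (h2 : β < 2) (μ₁ μ₂ : Measure H)
    [IsProbabilityMeasure μ₁] [IsProbabilityMeasure μ₂]
    (hm1 : ∃ x₀, Integrable (fun x => ‖x - x₀‖ ^ β) μ₁)
    (hm2 : ∃ x₀, Integrable (fun x => ‖x - x₀‖ ^ β) μ₂)
    (hD : (∫ p : H × H, ‖p.1 - p.2‖ ^ β ∂(μ₁.prod μ₁))
      - 2 * (∫ p : H × H, ‖p.1 - p.2‖ ^ β ∂(μ₁.prod μ₂))
      + (∫ p : H × H, ‖p.1 - p.2‖ ^ β ∂(μ₂.prod μ₂)) = 0) : μ₁ = μ₂ := by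
  obtain ⟨i11, e11⟩ := fubini_rho h0 h2 μ₁ μ₁ (integrable_rho β h0 μ₁ μ₁ hm1 hm1)
  obtain ⟨i12, e12⟩ := fubini_rho h0 h2 μ₁ μ₂ (integrable_rho β h0 μ₁ μ₂ hm1 hm2)
  obtain ⟨i22, e22⟩ := fubini_rho h0 h2 μ₂ μ₂ (integrable_rho β h0 μ₂ μ₂ hm2 hm2)
  let M : ℝ → ℝ := fun t => (∫ p : H × H, Real.exp (-t * ‖p.1 - p.2‖ ^ 2) ∂(μ₁.prod μ₁))
      - 2 * (∫ p : H × H, Real.exp (-t * ‖p.1 - p.2‖ ^ 2) ∂(μ₁.prod μ₂))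
      + (∫ p : H × H, Real.exp (-t * ‖p.1 - p.2‖ ^ 2) ∂(μ₂.prod μ₂))
  have hM : (fun t => wfun β t * M t) = fun t => 2 * (wfun β t *
      (1 - ∫ p : H × H, Real.exp (-t * ‖p.1 - p.2‖ ^ 2) ∂(μ₁.prod μ₂)))
      - wfun β t * (1 - ∫ p : H × H, Real.exp (-t * ‖p.1 - p.2‖ ^ 2) ∂(μ₁.prod μ₁))
      - wfun β t * (1 - ∫ p : H × H, Real.exp (-t * ‖p.1 - p.2‖ ^ 2) ∂(μ₂.prod μ₂)) := by
    ext t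
    simp only [M]; ring
  have hi : IntegrableOn (fun t => wfun β t * M t) (Set.Ioi 0) := by
    rw [hM]
    exact ((i12.const_mul 2).sub i11).sub i22
  have hz : ∫ t in Set.Ioi (0 : ℝ), wfun β t * M t = 0 := by
    have a1 := integral_sub ((i12.const_mul 2).sub i11) i22
    have a2 := integral_sub (i12.const_mul 2) i11
    simp only [Pi.sub_apply] at a1 a2
    rw [hM, a1, a2, integral_const_mul, e11, e12, e22]
    linear_combination (-cst β) * hD
  rw [setIntegral_eq_zero_iff_of_nonneg_ae _ hi] at hz
  · have hz2 : ∀ᵐ t ∂(volume.restrict (Set.Ioi (0 : ℝ))), t ∈ Set.Ioi (0 : ℝ) :=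
      ae_restrict_mem measurableSet_Ioi
    have : (ae (volume.restrict (Set.Ioi (0 : ℝ)))).NeBot := by
      rw [ae_neBot]
      simp [Measure.restrict_eq_zero]
    obtain ⟨t, ht1, ht2⟩ := (hz.and hz2).exists
    have ht2 : 0 < t := ht2
    have hw : wfun β t ≠ 0 := (Real.rpow_pos_of_pos ht2 _).ne'
    have hMt : M t = 0 := by
      simpa [hw] using ht1
    exact eq_of_gauss ht2 μ₁ μ₂ ((mean_embedding ht2 μ₁ μ₂).2 hMt)
  · refine (ae_restrict_iff' measurableSet_Ioi).mpr (.of_forall fun t ht => ?_)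
    have ht : 0 < t := ht
    exact mul_nonneg (Real.rpow_nonneg ht.le _) (mean_embedding ht μ₁ μ₂).1

end strong

/-- If `(H, ‖·‖)` is a separable Hilbert space, then `(H, ‖·‖^β)` is of
negative type for every `β ∈ (0,2]`, and of strong negative type for every `β ∈ (0,2)`. -/
theorem hilbert_power_negative_type
    {H : Type*} [NormedAddCommGroup H] [InnerProductSpace ℝ H] [CompleteSpace H]
    [TopologicalSpace.SeparableSpace H] [MeasurableSpace H] [BorelSpace H] :
    (∀ β ∈ Set.Ioc (0 : ℝ) 2,
      IsNegativeType (fun x x' : H => ‖x - x'‖ ^ β)) ∧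
    (∀ β ∈ Set.Ioo (0 : ℝ) 2,
      IsStrongNegativeType (fun x x' : H => ‖x - x'‖ ^ β)) := by
  exact ⟨fun β hβ => isNegativeType_of_mem hβ.1 hβ.2, fun β hβ =>
    ⟨isNegativeType_of_mem hβ.1 hβ.2.le, fun μ₁ μ₂ _ _ h1 h2 hD =>
      strong_aux hβ.1 hβ.2 μ₁ μ₂ h1 h2 hD⟩⟩
end
end

section
/- Let (𝒳, d) and (𝒴, d) be separable metric spaces and θ = μ ⊗ ν a product probability measure on 𝒳 × 𝒴 whose marginals μ and ν have finite first moments. Define f(x₁, x₂, x₃, x₄) := d(x₁, x₂) − d(x₁, x₃) − d(x₂, x₄) + d(x₃, x₄), h(z₁, ..., z₆) := f(x₁, x₂, x₃, x₄) f(y₁, y₂, y₅, y₆) for z_i = (x_i, y_i), and let h̄ be the symmetrization h̄(z₁, ..., z₆) := (1/6!) Σ_{σ∈S₆} h(z_{σ(1)}, ..., z_{σ(6)}). Then for all z₁, z₂ ∈ 𝒳 × 𝒴, ∫ h̄(z₁, z₂, z₃, z₄, z₅, z₆) dθ⁴(z₃, z₄, z₅, z₆) = δ_θ(z₁, z₂)/15.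 -/
open MeasureTheory Filter Topology

noncomputable section

/-- The kernel `f(x₁,x₂,x₃,x₄) = d(x₁,x₂) − d(x₁,x₃) − d(x₂,x₄) + d(x₃,x₄)`. -/
def fKer {X : Type*} [MetricSpace X] (x₁ x₂ x₃ x₄ : X) : ℝ :=
  dist x₁ x₂ - dist x₁ x₃ - dist x₂ x₄ + dist x₃ x₄

/-- `h(z₁,…,z₆) = f(x₁,x₂,x₃,x₄) f(y₁,y₂,y₅,y₆)` (0-based indexing). -/
def hKer {X Y : Type*} [MetricSpace X] [MetricSpace Y] (z : Fin 6 → X × Y) : ℝ :=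
  fKer (z 0).1 (z 1).1 (z 2).1 (z 3).1 * fKer (z 0).2 (z 1).2 (z 4).2 (z 5).2

/-- The symmetrization `h̄` of `h` over the symmetric group `S₆`. -/
def hBar {X Y : Type*} [MetricSpace X] [MetricSpace Y] (z : Fin 6 → X × Y) : ℝ :=
  ((6).factorial : ℝ)⁻¹ * ∑ σ : Equiv.Perm (Fin 6), hKer (z ∘ σ)

/-- Sign with which a permuted kernel integrates to `d_μ`. -/
def sgK (a b c d : Fin 6) : ℤ :=
  if (a = 0 ∧ b = 1) ∨ (a = 1 ∧ b = 0) ∨ (c = 0 ∧ d = 1) ∨ (c = 1 ∧ d = 0) then 1 else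
  if (a = 0 ∧ c = 1) ∨ (a = 1 ∧ c = 0) ∨ (b = 0 ∧ d = 1) ∨ (b = 1 ∧ d = 0) then -1 else 0

theorem sgK_mul (a b c d e f : Fin 6) (hac : a ≠ c) (hae : a ≠ e) (had : a ≠ d) (haf : a ≠ f)
    (hbc : b ≠ c) (hbd : b ≠ d) (hbe : b ≠ e) (hbf : b ≠ f) (hce : c ≠ e) (hcf : c ≠ f)
    (hde : d ≠ e) (hdf : d ≠ f) :
    sgK a b c d * sgK a b e f = if (a = 0 ∧ b = 1) ∨ (a = 1 ∧ b = 0) then 1 else 0 := by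
  unfold sgK
  grind

theorem perm_sum (g : Fin 6 → Fin 6 → ℤ) :
    ∑ σ : Equiv.Perm (Fin 6), g (σ 0) (σ 1)
      = ∑ p : Fin 6, ∑ q : Fin 5, 24 * g p (Equiv.swap 0 p q.succ) := by
  rw [← Equiv.sum_comp Equiv.Perm.decomposeFin.symm, Fintype.sum_prod_type]
  refine Finset.sum_congr rfl fun p _ => ?_
  rw [← Equiv.sum_comp Equiv.Perm.decomposeFin.symm, Fintype.sum_prod_type]
  refine Finset.sum_congr rfl fun q _ => ?_
  have h1 : ∀ τ : Equiv.Perm (Fin 5),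
      Equiv.Perm.decomposeFin.symm (p, τ) (1 : Fin 6) = Equiv.swap 0 p (τ 0).succ :=
    fun τ => Equiv.Perm.decomposeFin_symm_apply_succ τ p 0
  simp only [h1, Equiv.Perm.decomposeFin_symm_apply_zero]
  rw [Finset.sum_const, Finset.card_univ, Fintype.card_perm, Fintype.card_fin]
  simp [Nat.factorial]

theorem sgK_sum : ∑ σ : Equiv.Perm (Fin 6),
    sgK (σ 0) (σ 1) (σ 2) (σ 3) * sgK (σ 0) (σ 1) (σ 4) (σ 5) = 48 := by
  have h : ∀ σ : Equiv.Perm (Fin 6),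
      sgK (σ 0) (σ 1) (σ 2) (σ 3) * sgK (σ 0) (σ 1) (σ 4) (σ 5)
        = (fun a b : Fin 6 => if (a = 0 ∧ b = 1) ∨ (a = 1 ∧ b = 0) then (1 : ℤ) else 0)
            (σ 0) (σ 1) := by
    intro σ
    apply sgK_mul
    all_goals exact fun h' => absurd (σ.injective h') (by decide)
  rw [Finset.sum_congr rfl fun σ _ => h σ]
  refine (perm_sum (fun a b : Fin 6 =>
    if (a = 0 ∧ b = 1) ∨ (a = 1 ∧ b = 0) then (1 : ℤ) else 0)).trans ?_
  decide

def eF (m a b D : ℝ) (i j : Fin 6) : ℝ :=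
  if i = 0 then (if j = 1 then m else a) else
  if i = 1 then (if j = 0 then m else b) else
  if j = 0 then a else if j = 1 then b else D

theorem eF_sgK (m A B D : ℝ) (a b c d : Fin 6) (h1 : a ≠ b) (h2 : a ≠ c) (h3 : a ≠ d)
    (h4 : b ≠ c) (h5 : b ≠ d) (h6 : c ≠ d) :
    eF m A B D a b - eF m A B D a c - eF m A B D b d + eF m A B D c d
      = sgK a b c d * (m - A - B + D) := by
  by_cases a0 : a = 0 <;> by_cases a1 : a = 1 <;> by_cases b0 : b = 0 <;> by_cases b1 : b = 1 <;>
  by_cases c0 : c = 0 <;> by_cases c1 : c = 1 <;> by_cases d0 : d = 0 <;> by_cases d1 : d = 1 <;>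
  first | (exfalso; simp_all; done) | (simp [eF, sgK, *]; done) | (simp [eF, sgK, *]; ring)

/-- The six points. -/
def vec6 {X : Type*} (x₁ x₂ : X) (w : Fin 4 → X) : Fin 6 → X := Fin.cons x₁ (Fin.cons x₂ w)

theorem vec6_cases (i : Fin 6) : i = 0 ∨ i = 1 ∨ ∃ j : Fin 4, i = j.succ.succ := by
  refine Fin.cases (Or.inl rfl) (fun i => ?_) i
  refine Fin.cases (Or.inr (Or.inl rfl)) (fun j => Or.inr (Or.inr ⟨j, rfl⟩)) i

section aux
variable {X : Type*} [MetricSpace X] [TopologicalSpace.SeparableSpace X] [MeasurableSpace X]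
  [BorelSpace X] (μ : Measure X) [IsProbabilityMeasure μ] (x₀ : X)

theorem vec6_meas (x₁ x₂ : X) (i : Fin 6) : Measurable (fun w => vec6 x₁ x₂ w i) := by
  rcases vec6_cases i with rfl | rfl | ⟨j, rfl⟩
  · exact measurable_const
  · exact measurable_const
  · exact measurable_pi_apply j

theorem vec6_int0 (h : Integrable (fun x => dist x x₀) μ) (x₁ x₂ : X) (i : Fin 6) :
    Integrable (fun w => dist (vec6 x₁ x₂ w i) x₀) (Measure.pi fun _ : Fin 4 => μ) := by
  rcases vec6_cases i with rfl | rfl | ⟨j, rfl⟩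
  · exact integrable_const (dist x₁ x₀)
  · exact integrable_const (dist x₂ x₀)
  · exact (measurePreserving_eval (fun _ : Fin 4 => μ) j).integrable_comp_of_integrable h

theorem vec6_int (h : Integrable (fun x => dist x x₀) μ) (x₁ x₂ : X) (i j : Fin 6) :
    Integrable (fun w => dist (vec6 x₁ x₂ w i) (vec6 x₁ x₂ w j))
      (Measure.pi fun _ : Fin 4 => μ) := by
  have : SecondCountableTopology X := UniformSpace.secondCountable_of_separable X
  refine Integrable.mono' ((vec6_int0 μ x₀ h x₁ x₂ i).add (vec6_int0 μ x₀ h x₁ x₂ j))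
    (((vec6_meas x₁ x₂ i).dist (vec6_meas x₁ x₂ j)).aestronglyMeasurable) ?_
  refine Filter.Eventually.of_forall fun w => ?_
  rw [Real.norm_of_nonneg dist_nonneg]
  exact dist_triangle_right _ _ _

theorem pair_mp (i j : Fin 4) (hij : i ≠ j) :
    MeasurePreserving (fun w : Fin 4 → X => (w i, w j)) (Measure.pi fun _ : Fin 4 => μ)
      (μ.prod μ) := by
  refine ⟨by fun_prop, ?_⟩
  have hi := (ProbabilityTheory.iIndepFun_pi (μ := fun _ : Fin 4 => μ)
    (X := fun _ : Fin 4 => (id : X → X)) (fun _ => aemeasurable_id)).indepFun hij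
  rw [ProbabilityTheory.indepFun_iff_map_prod_eq_prod_map_map
    (by exact (measurable_pi_apply i).aemeasurable)
    (by exact (measurable_pi_apply j).aemeasurable)] at hi
  have e : ∀ k : Fin 4, (Measure.pi fun _ : Fin 4 => μ).map (fun w => id (w k)) = μ :=
    fun k => (measurePreserving_eval (fun _ : Fin 4 => μ) k).map_eq
  rw [e, e] at hi
  exact hi

theorem vec6_dist_integral (x₁ x₂ : X) (i j : Fin 6) (hij : i ≠ j) :
    ∫ w, dist (vec6 x₁ x₂ w i) (vec6 x₁ x₂ w j) ∂(Measure.pi fun _ : Fin 4 => μ)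
      = eF (dist x₁ x₂) (aM (fun a b : X => dist a b) μ x₁) (aM (fun a b : X => dist a b) μ x₂)
          (DM (fun a b : X => dist a b) μ) i j := by
  have : SecondCountableTopology X := UniformSpace.secondCountable_of_separable X
  have key : ∀ (x : X) (k : Fin 4), ∫ w : Fin 4 → X, dist x (w k) ∂(Measure.pi fun _ : Fin 4 => μ)
      = aM (fun a b : X => dist a b) μ x := by
    intro x k
    have hp := measurePreserving_eval (fun _ : Fin 4 => μ) k
    rw [aM]
    conv_rhs => rw [← hp.map_eq]
    rw [integral_map hp.measurable.aemeasurable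
      (by exact (measurable_const.dist measurable_id).aestronglyMeasurable)]
  have v0 : ∀ w, vec6 x₁ x₂ w 0 = x₁ := fun _ => rfl
  have v1 : ∀ w, vec6 x₁ x₂ w 1 = x₂ := fun _ => rfl
  have v2 : ∀ w (k : Fin 4), vec6 x₁ x₂ w k.succ.succ = w k := fun _ _ => rfl
  have n0 : ∀ k : Fin 4, k.succ.succ ≠ (0 : Fin 6) := fun k => Fin.succ_ne_zero _
  have n1 : ∀ k : Fin 4, k.succ.succ ≠ (1 : Fin 6) := by decide
  rcases vec6_cases i with rfl | rfl | ⟨k, rfl⟩ <;> rcases vec6_cases j with rfl | rfl | ⟨l, rfl⟩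
  · exact absurd rfl hij
  · simp [eF, v0, v1]
  · simp only [v0, v2, key, eF, n1, if_true, if_false]
  · simp [eF, v0, v1, dist_comm]
  · exact absurd rfl hij
  · simp [v1, v2, key, eF, n0]
  · simp_rw [v0, v2, dist_comm _ x₁, key]; simp [eF, n0, n1]
  · simp_rw [v1, v2, dist_comm _ x₂, key]; simp [eF, n0, n1]
  · have hkl : k ≠ l := fun h => hij (by rw [h])
    have hp := pair_mp μ k l hkl
    have : eF (dist x₁ x₂) (aM (fun a b : X => dist a b) μ x₁)
        (aM (fun a b : X => dist a b) μ x₂) (DM (fun a b : X => dist a b) μ)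
        k.succ.succ l.succ.succ = DM (fun a b : X => dist a b) μ := by
      simp only [eF, n0, n1, if_false]
    rw [this, DM, ← hp.map_eq, integral_map hp.measurable.aemeasurable
      (by exact (measurable_fst.dist measurable_snd).aestronglyMeasurable)]
    rfl

theorem vec6_fKer_int (h : Integrable (fun x => dist x x₀) μ) (x₁ x₂ : X) (a b c d : Fin 6) :
    Integrable (fun w => fKer (vec6 x₁ x₂ w a) (vec6 x₁ x₂ w b) (vec6 x₁ x₂ w c)
      (vec6 x₁ x₂ w d)) (Measure.pi fun _ : Fin 4 => μ) :=
  (((vec6_int μ x₀ h x₁ x₂ a b).sub (vec6_int μ x₀ h x₁ x₂ a c)).sub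
    (vec6_int μ x₀ h x₁ x₂ b d)).add (vec6_int μ x₀ h x₁ x₂ c d)

theorem vec6_fKer_integral (h : Integrable (fun x => dist x x₀) μ) (x₁ x₂ : X)
    (a b c d : Fin 6) (h1 : a ≠ b) (h2 : a ≠ c) (h3 : a ≠ d)
    (h4 : b ≠ c) (h5 : b ≠ d) (h6 : c ≠ d) :
    ∫ w, fKer (vec6 x₁ x₂ w a) (vec6 x₁ x₂ w b) (vec6 x₁ x₂ w c)
      (vec6 x₁ x₂ w d) ∂(Measure.pi fun _ : Fin 4 => μ)
      = sgK a b c d * dM (fun a b : X => dist a b) μ x₁ x₂ := by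
  have I := vec6_int μ x₀ h x₁ x₂
  unfold fKer
  rw [integral_add (by exact ((I a b).sub (I a c)).sub (I b d)) (I c d),
    integral_sub (by exact (I a b).sub (I a c)) (I b d), integral_sub (I a b) (I a c),
    vec6_dist_integral μ x₁ x₂ a b h1, vec6_dist_integral μ x₁ x₂ a c h2,
    vec6_dist_integral μ x₁ x₂ b d h5, vec6_dist_integral μ x₁ x₂ c d h6]
  exact eF_sgK _ _ _ _ a b c d h1 h2 h3 h4 h5 h6

end aux

/-- For a product measure `θ = μ ⊗ ν` with marginals of finite first
moments, `∫ h̄(z₁,z₂,·) dθ⁴ = δ_θ(z₁,z₂)/15` for all `z₁, z₂`. -/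
theorem hBar_integral_eq_deltaTheta_div_15
    {X Y : Type*}
    [MetricSpace X] [TopologicalSpace.SeparableSpace X] [MeasurableSpace X] [BorelSpace X]
    [MetricSpace Y] [TopologicalSpace.SeparableSpace Y] [MeasurableSpace Y] [BorelSpace Y]
    (μ : Measure X) (ν : Measure Y) [IsProbabilityMeasure μ] [IsProbabilityMeasure ν]
    (x₀ : X) (y₀ : Y)
    (hmomX : Integrable (fun x => dist x x₀) μ)
    (hmomY : Integrable (fun y => dist y y₀) ν)
    (θ : Measure (X × Y)) (hθ : θ = μ.prod ν) :
    ∀ z₁ z₂ : X × Y,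
      ∫ w : Fin 4 → X × Y, hBar (Fin.cons z₁ (Fin.cons z₂ w))
          ∂(Measure.pi fun _ : Fin 4 => θ)
        = deltaTheta (fun a b : X => dist a b) (fun a b : Y => dist a b) θ z₁ z₂ / 15 := by
  subst hθ
  intro z₁ z₂
  have hp := measurePreserving_arrowProdEquivProdArrow X Y (Fin 4) (fun _ => μ) (fun _ => ν)
  set e := MeasurableEquiv.arrowProdEquivProdArrow X Y (Fin 4) with he
  -- the factorized kernel
  let G : Equiv.Perm (Fin 6) → (Fin 4 → X) × (Fin 4 → Y) → ℝ := fun σ p =>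
    fKer (vec6 z₁.1 z₂.1 p.1 (σ 0)) (vec6 z₁.1 z₂.1 p.1 (σ 1)) (vec6 z₁.1 z₂.1 p.1 (σ 2))
      (vec6 z₁.1 z₂.1 p.1 (σ 3)) *
    fKer (vec6 z₁.2 z₂.2 p.2 (σ 0)) (vec6 z₁.2 z₂.2 p.2 (σ 1)) (vec6 z₁.2 z₂.2 p.2 (σ 4))
      (vec6 z₁.2 z₂.2 p.2 (σ 5))
  have hG : ∀ (σ : Equiv.Perm (Fin 6)) (w : Fin 4 → X × Y),
      hKer ((Fin.cons z₁ (Fin.cons z₂ w) : Fin 6 → X × Y) ∘ σ) = G σ (e w) := by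
    intro σ w
    have c1 : ∀ i : Fin 6, ((Fin.cons z₁ (Fin.cons z₂ w) : Fin 6 → X × Y) i).1
        = vec6 z₁.1 z₂.1 (e w).1 i := by
      intro i
      rcases vec6_cases i with rfl | rfl | ⟨j, rfl⟩ <;> rfl
    have c2 : ∀ i : Fin 6, ((Fin.cons z₁ (Fin.cons z₂ w) : Fin 6 → X × Y) i).2
        = vec6 z₁.2 z₂.2 (e w).2 i := by
      intro i
      rcases vec6_cases i with rfl | rfl | ⟨j, rfl⟩ <;> rfl
    simp only [hKer, Function.comp, c1, c2, G]
  have hGi : ∀ σ, Integrable (fun w => G σ (e w))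
      (Measure.pi fun _ : Fin 4 => μ.prod ν) := fun σ =>
    hp.integrable_comp_of_integrable
      ((vec6_fKer_int μ x₀ hmomX z₁.1 z₂.1 (σ 0) (σ 1) (σ 2) (σ 3)).mul_prod
        (vec6_fKer_int ν y₀ hmomY z₁.2 z₂.2 (σ 0) (σ 1) (σ 4) (σ 5)))
  have hne : ∀ (σ : Equiv.Perm (Fin 6)) (i j : Fin 6), i ≠ j → σ i ≠ σ j :=
    fun σ i j h h' => h (σ.injective h')
  have hval : ∀ σ, ∫ w, G σ (e w) ∂(Measure.pi fun _ : Fin 4 => μ.prod ν)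
      = ((sgK (σ 0) (σ 1) (σ 2) (σ 3) * sgK (σ 0) (σ 1) (σ 4) (σ 5) : ℤ) : ℝ) *
        (dM (fun a b : X => dist a b) μ z₁.1 z₂.1 *
          dM (fun a b : Y => dist a b) ν z₁.2 z₂.2) := by
    intro σ
    rw [hp.integral_comp' (G σ)]
    simp only [G]
    rw [integral_prod_mul
      (fun p => fKer (vec6 z₁.1 z₂.1 p (σ 0)) (vec6 z₁.1 z₂.1 p (σ 1)) (vec6 z₁.1 z₂.1 p (σ 2))
        (vec6 z₁.1 z₂.1 p (σ 3)))
      (fun p => fKer (vec6 z₁.2 z₂.2 p (σ 0)) (vec6 z₁.2 z₂.2 p (σ 1)) (vec6 z₁.2 z₂.2 p (σ 4))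
        (vec6 z₁.2 z₂.2 p (σ 5))),
      vec6_fKer_integral μ x₀ hmomX, vec6_fKer_integral ν y₀ hmomY]
    · push_cast; ring
    all_goals exact hne σ _ _ (by decide)
  simp only [hBar, hG]
  rw [integral_const_mul, integral_finsetSum _ (fun σ _ => hGi σ)]
  simp only [hval]
  rw [← Finset.sum_mul, ← Int.cast_sum, sgK_sum]
  have m1 : (μ.prod ν).map Prod.fst = μ := by simp
  have m2 : (μ.prod ν).map Prod.snd = ν := by simp
  rw [deltaTheta, m1, m2]
  norm_num [Nat.factorial]
  ring
end
end
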